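/- arXiv:2501.05096 — 11 statements merged into one kernel-verified Lean document; each statement's English description precedes it below -/
import Mathlib

section
/- The set of cluster points of the real sequence n ↦ (sin n)^n (n ∈ ℕ, integer exponent, sin in radians) is exactly the interval [−1, 1]; that is, a real number λ is a cluster point of this sequence (there exists a strictly increasing sequence of natural numbers n_k with (sin n_k)^{n_k} → λ) if and only if λ ∈ [−1, 1]. -/
open Filter Topology

/-- An irrational number has rational approximations of quality `1 / den ^ 2` with arbitrarily large
denominators. -/
lemma Irrational.exists_rat_lt_den {α : ℝ} (hα : Irrational α) (D : ℕ) :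
    ∃ r : ℚ, D < r.den ∧ |α - r| ≤ 1 / (r.den : ℝ) ^ 2 := by
  obtain ⟨ε, hε, hpos⟩ := ((hα.eventually_forall_le_dist_cast_rat_of_den_le D).filter_mono
    nhdsWithin_le_nhds |>.and (self_mem_nhdsWithin (s := Set.Ioi (0 : ℝ)))).exists
  obtain ⟨n, hn⟩ := exists_nat_one_div_lt hpos
  obtain ⟨r, hr, hden⟩ := Real.exists_rat_abs_sub_le_and_den_le α (n := n + 1) n.succ_pos
  have hq : (1 : ℝ) ≤ r.den := by exact_mod_cast r.pos
  have hqn : (r.den : ℝ) ≤ n + 1 := by exact_mod_cast hden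
  refine ⟨r, ?_, hr.trans ?_⟩
  · by_contra! h
    have h1 : ε ≤ |α - r| := hε r h
    have h2 : 1 / (((n + 1 : ℕ) + 1 : ℝ) * r.den) ≤ 1 / ((n : ℝ) + 1) := by
      apply one_div_le_one_div_of_le (by positivity)
      push_cast
      nlinarith
    linarith
  · apply one_div_le_one_div_of_le (by positivity)
    push_cast
    nlinarith

/-- If `|α - r| ≤ 1 / q ^ 2` with `q = r.den`, then `q` consecutive multiples of `α` are
`2 / q`-dense modulo one. -/
lemma exists_abs_mul_sub_sub_le {α : ℝ} {r : ℚ} (hr : |α - r| ≤ 1 / (r.den : ℝ) ^ 2) (M : ℕ)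
    (T : ℝ) : ∃ (m : ℕ) (k : ℤ), M ≤ m ∧ m < M + r.den ∧ |m * α - k - T| ≤ 2 / r.den := by
  have hq : 0 < r.den := r.pos
  have hq' : (0 : ℝ) < r.den := by exact_mod_cast hq
  have hqz : (0 : ℤ) < r.den := by exact_mod_cast hq
  obtain ⟨a, b, hab⟩ : IsCoprime r.num (r.den : ℤ) := by
    rw [Int.isCoprime_iff_gcd_eq_one]
    simpa [Int.gcd] using r.reduced
  set x : ℝ := T - M * α with hx
  set j : ℤ := ⌊r.den * x⌋
  obtain ⟨i, hi⟩ := Int.eq_ofNat_of_zero_le (Int.emod_nonneg (j * a) hqz.ne')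
  have hilt : i < r.den := by
    have := Int.emod_lt_of_pos (j * a) hqz
    omega
  set k : ℤ := -(j * b) - (j * a / r.den) * r.num with hk
  have hik : (i : ℤ) * r.num = j + r.den * k := by
    have h := Int.emod_add_mul_ediv (j * a) r.den
    rw [hi] at h
    rw [hk]
    linear_combination r.num * h + j * hab
  have hik' : (i : ℝ) * r = j / r.den + k := by
    have h1 : (i : ℝ) * r.num = j + r.den * k := by exact_mod_cast hik
    rw [Rat.cast_def]
    field_simp
    linarith
  refine ⟨M + i, k, by omega, by omega, ?_⟩
  have e : ((M + i : ℕ) : ℝ) * α - k - T = i * (α - r) + (j / r.den - x) := by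
    push_cast
    rw [hx]
    linear_combination hik'
  have h1 : |(i : ℝ) * (α - r)| ≤ 1 / r.den := by
    rw [abs_mul, abs_of_nonneg (Nat.cast_nonneg i)]
    calc (i : ℝ) * |α - r| ≤ r.den * (1 / (r.den : ℝ) ^ 2) := by gcongr
      _ = 1 / r.den := by field_simp
  have h2 : |(j : ℝ) / r.den - x| ≤ 1 / r.den := by
    have e2 : (j : ℝ) / r.den - x = (j - r.den * x) / r.den := by field_simp
    rw [e2, abs_div, abs_of_pos hq']
    gcongr
    rw [abs_le]
    constructor <;> linarith [Int.floor_le (r.den * x), Int.lt_floor_add_one (r.den * x)]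
  rw [e]
  calc _ ≤ _ := abs_add_le _ _
    _ ≤ 1 / (r.den : ℝ) + 1 / r.den := add_le_add h1 h2
    _ = 2 / r.den := by ring

lemma tendsto_div_sqrt_nat_floor_add {c : ℝ} (hc : 0 < c) {d : ℕ → ℝ}
    (hd : Tendsto (fun q : ℕ => d q / (q : ℝ) ^ 2) atTop (𝓝 0)) :
    Tendsto (fun q : ℕ => (q : ℝ) / √(2 * ⌊c * (q : ℝ) ^ 2⌋₊ + d q)) atTop (𝓝 (1 / √(2 * c))) := by
  have hsq : Tendsto (fun q : ℕ => (q : ℝ) ^ 2) atTop atTop :=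
    (tendsto_pow_atTop two_ne_zero).comp tendsto_natCast_atTop_atTop
  have h1 := (((tendsto_nat_floor_mul_div_atTop hc.le).comp hsq).const_mul 2).add hd
  have h2 := (h1.sqrt).inv₀ (by rw [add_zero]; positivity)
  rw [add_zero, ← one_div] at h2
  refine h2.congr' ?_
  filter_upwards [eventually_gt_atTop 0] with q hq
  have hq' : (0 : ℝ) < q := by exact_mod_cast hq
  have e : 2 * ((⌊c * (q : ℝ) ^ 2⌋₊ : ℝ) / (q : ℝ) ^ 2) + d q / (q : ℝ) ^ 2
      = (2 * ⌊c * (q : ℝ) ^ 2⌋₊ + d q) / (q : ℝ) ^ 2 := by ring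
  simp only [Function.comp_apply]
  rw [e, Real.sqrt_div' _ (by positivity), Real.sqrt_sq hq'.le, inv_div]

/-- Inhomogeneous approximation of prescribed quality: for irrational `α`, the fractional part of
`m * α + β` falls infinitely often into `[a / √(2 * m + 1), b / √(2 * m + 1)]`. -/
lemma Irrational.exists_mul_add_sub_mem_Icc {α : ℝ} (hα : Irrational α) (β : ℝ) {a b : ℝ}
    (ha : 0 ≤ a) (hab : a < b) (N : ℕ) :
    ∃ (m : ℕ) (k : ℤ), N ≤ m ∧
      m * α + β - k ∈ Set.Icc (a / √(2 * m + 1)) (b / √(2 * m + 1)) := by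
  have hb : 0 < b := ha.trans_lt hab
  set η : ℝ := (b - a) / 5 with hη
  have hη0 : 0 < η := by rw [hη]; linarith
  set c : ℝ := η ^ 2 / 2 with hc
  have hc0 : 0 < c := by positivity
  have hsc : √(2 * c) = η := by
    rw [hc, mul_div_cancel₀ _ two_ne_zero, Real.sqrt_sq hη0.le]
  have hinv : Tendsto (fun q : ℕ => (1 : ℝ) / q) atTop (𝓝 0) := tendsto_one_div_atTop_nhds_zero_nat
  have hd1 : Tendsto (fun q : ℕ => (1 : ℝ) / (q : ℝ) ^ 2) atTop (𝓝 0) := by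
    simpa [div_pow] using hinv.pow 2
  have hd2 : Tendsto (fun q : ℕ => 2 * (q : ℝ) / (q : ℝ) ^ 2) atTop (𝓝 0) := by
    refine (by simpa using hinv.const_mul 2 :
      Tendsto (fun q : ℕ => 2 * ((1 : ℝ) / q)) atTop (𝓝 0)).congr' ?_
    filter_upwards [eventually_gt_atTop 0] with q hq
    have hq' : (0 : ℝ) < q := by exact_mod_cast hq
    field_simp
  have hlim := ((tendsto_div_sqrt_nat_floor_add hc0 hd2).const_mul b).sub
    ((tendsto_div_sqrt_nat_floor_add hc0 hd1).const_mul a)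
  have hlt : (4 : ℝ) < b * (1 / √(2 * c)) - a * (1 / √(2 * c)) := by
    rw [hsc, ← sub_mul, mul_one_div, lt_div_iff₀ hη0]
    rw [hη]; linarith
  have hMt : Tendsto (fun q : ℕ => ⌊c * (q : ℝ) ^ 2⌋₊) atTop atTop :=
    tendsto_nat_floor_atTop.comp (((tendsto_pow_atTop two_ne_zero).comp
      tendsto_natCast_atTop_atTop).const_mul_atTop hc0)
  obtain ⟨D, hD⟩ := eventually_atTop.1
    ((hlim.eventually (lt_mem_nhds hlt)).and (hMt.eventually_ge_atTop N))
  obtain ⟨r, hrD, hr⟩ := hα.exists_rat_lt_den D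
  obtain ⟨hgap, hMN⟩ := hD r.den hrD.le
  set M := ⌊c * (r.den : ℝ) ^ 2⌋₊
  have hq : (0 : ℝ) < r.den := by exact_mod_cast r.pos
  obtain ⟨m, k, hMm, hmM, hmk⟩ :=
    exists_abs_mul_sub_sub_le hr M (a / √(2 * M + 1) + 2 / r.den - β)
  have hMm' : (M : ℝ) ≤ m := by exact_mod_cast hMm
  have hmM' : (m : ℝ) + 1 ≤ M + r.den := by exact_mod_cast hmM
  obtain ⟨hl, hu⟩ := abs_le.1 hmk
  refine ⟨m, k, hMN.trans hMm, ?_, ?_⟩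
  · have : a / √(2 * m + 1) ≤ a / √(2 * M + 1) := by gcongr
    linarith
  · have h1 : b / √(2 * M + 2 * r.den) ≤ b / √(2 * m + 1) := by
      refine div_le_div_of_nonneg_left hb.le (by positivity) (Real.sqrt_le_sqrt ?_)
      linarith
    have h2 : a / √(2 * M + 1) + 4 / r.den ≤ b / √(2 * M + 2 * r.den) := by
      rw [← mul_le_mul_iff_right₀ hq]
      have e1 : r.den * (a / √(2 * M + 1) + 4 / r.den) = a * (r.den / √(2 * M + 1)) + 4 := by
        field_simp
      have e2 : r.den * (b / √(2 * M + 2 * r.den)) = b * (r.den / √(2 * M + 2 * r.den)) := by ring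
      rw [e1, e2]
      linarith
    have e3 : (4 : ℝ) / r.den = 2 / r.den + 2 / r.den := by ring
    linarith

lemma tendsto_cos_div_sqrt_pow (x : ℝ) :
    Tendsto (fun n : ℕ => Real.cos (x / √n) ^ n) atTop (𝓝 (Real.exp (-(x ^ 2 / 2)))) := by
  have hg : Tendsto (fun n : ℕ => (n : ℝ) * (Real.cos (x / √n) - 1)) atTop
      (𝓝 (-(x ^ 2 / 2))) := by
    rw [tendsto_iff_dist_tendsto_zero]
    have hz : Tendsto (fun n : ℕ => x ^ 4 * (5 / 96) * (1 / (n : ℝ))) atTop (𝓝 0) := by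
      simpa using (tendsto_one_div_atTop_nhds_zero_nat (𝕜 := ℝ)).const_mul (x ^ 4 * (5 / 96))
    have hsm : Tendsto (fun n : ℕ => |x / √n|) atTop (𝓝 0) := by
      have := (tendsto_const_nhds (x := x)).div_atTop
        (Real.tendsto_sqrt_atTop.comp tendsto_natCast_atTop_atTop)
      simpa using this.abs
    refine squeeze_zero' (Eventually.of_forall fun n => dist_nonneg) ?_ hz
    filter_upwards [hsm.eventually (gt_mem_nhds one_pos), eventually_gt_atTop 0] with n hn hn0
    have hn' : (0 : ℝ) < n := by exact_mod_cast hn0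
    have hs : √(n : ℝ) ^ 2 = n := Real.sq_sqrt hn'.le
    have hsq : (x / √n) ^ 2 = x ^ 2 / n := by rw [div_pow, hs]
    have h4 : |x / √n| ^ 4 = x ^ 4 / n ^ 2 := by
      rw [Even.pow_abs (by decide), show 4 = 2 * 2 from rfl, pow_mul, hsq, div_pow, ← pow_mul]
    have hb := Real.cos_bound hn.le
    rw [hsq, h4] at hb
    rw [Real.dist_eq]
    calc _ = |(n : ℝ) * (Real.cos (x / √n) - (1 - x ^ 2 / n / 2))| := by
          congr 1
          field_simp
          ring
      _ = (n : ℝ) * |Real.cos (x / √n) - (1 - x ^ 2 / n / 2)| := by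
          rw [abs_mul, abs_of_pos hn']
      _ ≤ (n : ℝ) * (x ^ 4 / n ^ 2 * (5 / 96)) := by gcongr
      _ = _ := by field_simp
  simpa using Real.tendsto_one_add_pow_exp_of_tendsto hg

/-- For a sign `σ`, every value `σ * exp (-(s ^ 2 / 2))` is approached by `sin n ^ n`
along odd `n`. -/
lemma exists_abs_sin_pow_sub_lt {σ s : ℝ} (hσ : σ = 1 ∨ σ = -1) (hs : 0 ≤ s) {ε : ℝ} (hε : 0 < ε)
    (N : ℕ) : ∃ n ≥ N, |Real.sin n ^ n - σ * Real.exp (-(s ^ 2 / 2))| < ε := by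
  have hcont : Continuous fun t : ℝ => Real.exp (-(t ^ 2 / 2)) := by fun_prop
  obtain ⟨t, ht, hst⟩ := ((hcont.tendsto s).mono_left nhdsWithin_le_nhds |>.eventually
    (lt_mem_nhds (sub_lt_self _ hε)) |>.and (self_mem_nhdsWithin (s := Set.Ioi s))).exists
  have hst : s < t := hst
  have ht0 : 0 < t := hs.trans_lt hst
  have hsm : Tendsto (fun n : ℕ => t / √n) atTop (𝓝 0) :=
    (tendsto_const_nhds (x := t)).div_atTop
      (Real.tendsto_sqrt_atTop.comp tendsto_natCast_atTop_atTop)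
  obtain ⟨N₁, hN₁⟩ := eventually_atTop.1
    (((tendsto_cos_div_sqrt_pow t).eventually (lt_mem_nhds ht)).and
    (((tendsto_cos_div_sqrt_pow s).eventually (gt_mem_nhds (lt_add_of_pos_right _ hε))).and
      (hsm.eventually (gt_mem_nhds (by positivity : 0 < Real.pi / 2)))))
  have hπ := Real.pi_pos
  have hirr : Irrational (1 / Real.pi) := by
    rw [one_div]; exact irrational_pi.inv
  obtain ⟨m, k, hm, hl, hu⟩ := hirr.exists_mul_add_sub_mem_Icc
    ((1 - σ * (Real.pi / 2)) / (2 * Real.pi)) (a := s / (2 * Real.pi)) (b := t / (2 * Real.pi))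
    (by positivity) (by gcongr) (max N N₁)
  obtain ⟨hlow, hupp, hsmall⟩ := hN₁ (2 * m + 1) (by omega)
  refine ⟨2 * m + 1, by omega, ?_⟩
  set n : ℕ := 2 * m + 1 with hn
  have hnr : (n : ℝ) = 2 * m + 1 := by rw [hn]; push_cast; ring
  rw [← hnr] at hl hu
  set δ : ℝ := n - σ * (Real.pi / 2) - k * (2 * Real.pi) with hδ
  have hδe : m * (1 / Real.pi) + (1 - σ * (Real.pi / 2)) / (2 * Real.pi) - k
      = δ / (2 * Real.pi) := by
    rw [hδ, hnr]
    field_simp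
    ring
  rw [hδe, div_right_comm, div_le_div_iff_of_pos_right (by positivity)] at hl hu
  have hs0 : 0 ≤ s / √n := by positivity
  have hsin : Real.sin n = σ * Real.cos δ := by
    have e : (n : ℝ) = σ * (Real.pi / 2) + δ + k * (2 * Real.pi) := by rw [hδ]; ring
    rw [e, Real.sin_add_int_mul_two_pi, Real.sin_add]
    rcases hσ with rfl | rfl <;> simp
  have hσn : σ ^ n = σ := by
    rcases hσ with rfl | rfl
    · simp
    · exact Odd.neg_one_pow ⟨m, rfl⟩
  have hσa : |σ| = 1 := by rcases hσ with rfl | rfl <;> simp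
  have h1 : Real.cos (t / √n) ^ n ≤ Real.cos δ ^ n :=
    pow_le_pow_left₀ (Real.cos_nonneg_of_mem_Icc ⟨by linarith, hsmall.le⟩)
      (Real.cos_le_cos_of_nonneg_of_le_pi (hs0.trans hl) (by linarith) hu) _
  have h2 : Real.cos δ ^ n ≤ Real.cos (s / √n) ^ n :=
    pow_le_pow_left₀ (Real.cos_nonneg_of_mem_Icc ⟨by linarith, by linarith⟩)
      (Real.cos_le_cos_of_nonneg_of_le_pi hs0 (by linarith) hl) _
  rw [hsin, mul_pow, hσn, ← mul_sub, abs_mul, hσa, one_mul, abs_lt]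
  constructor <;> linarith

lemma exists_abs_sin_pow_sub_lt_of_ne_zero {lam : ℝ} (h0 : lam ≠ 0) (h1 : |lam| ≤ 1) {ε : ℝ}
    (hε : 0 < ε) (N : ℕ) : ∃ n ≥ N, |Real.sin n ^ n - lam| < ε := by
  have hpos : 0 < |lam| := abs_pos.2 h0
  have hlog : 0 ≤ -2 * Real.log |lam| := by linarith [Real.log_nonpos hpos.le h1]
  have hexp : Real.exp (-(√(-2 * Real.log |lam|) ^ 2 / 2)) = |lam| := by
    rw [Real.sq_sqrt hlog, show -(-2 * Real.log |lam| / 2) = Real.log |lam| by ring,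
      Real.exp_log hpos]
  obtain ⟨σ, hσ, hlam⟩ : ∃ σ : ℝ, (σ = 1 ∨ σ = -1) ∧ lam = σ * |lam| := by
    rcases abs_choice lam with h | h
    · exact ⟨1, Or.inl rfl, by rw [h, one_mul]⟩
    · exact ⟨-1, Or.inr rfl, by rw [h]; ring⟩
  have := exists_abs_sin_pow_sub_lt hσ (Real.sqrt_nonneg (-2 * Real.log |lam|)) hε N
  rwa [hexp, ← hlam] at this

lemma exists_abs_sin_pow_sub_lt_of_abs_le_one {lam : ℝ} (h1 : |lam| ≤ 1) {ε : ℝ}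
    (hε : 0 < ε) (N : ℕ) : ∃ n ≥ N, |Real.sin n ^ n - lam| < ε := by
  rcases eq_or_ne lam 0 with rfl | h0
  · have hδ : 0 < min 1 (ε / 2) := lt_min one_pos (half_pos hε)
    obtain ⟨n, hn, h⟩ := exists_abs_sin_pow_sub_lt_of_ne_zero hδ.ne'
      (by rw [abs_of_pos hδ]; exact min_le_left _ _) (half_pos hε) N
    refine ⟨n, hn, ?_⟩
    have := min_le_right 1 (ε / 2)
    rw [abs_lt] at h ⊢
    constructor <;> linarith
  · exact exists_abs_sin_pow_sub_lt_of_ne_zero h0 h1 hε N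

theorem stmt_1 (lam : ℝ) :
    (∃ n : ℕ → ℕ, StrictMono n ∧ (∀ k, 0 < n k) ∧
        Filter.Tendsto (fun k => Real.sin (n k) ^ (n k)) Filter.atTop (nhds lam))
      ↔ lam ∈ Set.Icc (-1 : ℝ) 1 := by
  constructor
  · rintro ⟨n, -, -, h⟩
    refine isClosed_Icc.mem_of_tendsto h (Eventually.of_forall fun k => ?_)
    rw [Set.mem_Icc, ← abs_le, abs_pow]
    exact pow_le_one₀ (abs_nonneg _) (Real.abs_sin_le_one _)
  · intro h
    have hc : MapClusterPt lam atTop fun n : ℕ => Real.sin (n + 1 : ℕ) ^ (n + 1) := by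
      refine mapClusterPt_iff_frequently.2 fun s hs => frequently_atTop.2 fun N => ?_
      obtain ⟨ε, hε, hball⟩ := Metric.mem_nhds_iff.1 hs
      obtain ⟨n, hn, hlt⟩ := exists_abs_sin_pow_sub_lt_of_abs_le_one (abs_le.2 h) hε (N + 1)
      obtain ⟨m, rfl⟩ : ∃ m, n = m + 1 := ⟨n - 1, by omega⟩
      exact ⟨m, by omega, hball hlt⟩
    obtain ⟨ψ, hψ, hlim⟩ := hc.tendsto_subseq
    exact ⟨fun k => ψ k + 1, fun _ _ hij => Nat.succ_lt_succ (hψ hij), fun k => Nat.succ_pos _,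
      hlim⟩
end

section
/- For every continuous function f : [0,1] → [0,∞), one has ∫₀¹ x³ f(x)² dx − ∫₀¹ x² f(x)³ dx ≤ 2/81. Moreover, for f(x) = (2/3)x the left-hand side equals 2/81. -/
theorem cube_mul_sq_sub_sq_mul_cube_le {x y : ℝ} (hx : 0 ≤ x) (hy : 0 ≤ y) :
    x ^ 3 * y ^ 2 - x ^ 2 * y ^ 3 ≤ 4 / 27 * x ^ 5 := by
  have h : 0 ≤ x ^ 2 * (y - 2 / 3 * x) ^ 2 * (y + x / 3) := by positivity
  linear_combination h

theorem stmt_2 (f : ℝ → ℝ) (hf : ContinuousOn f (Set.Icc 0 1))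
    (hpos : ∀ x ∈ Set.Icc (0 : ℝ) 1, 0 ≤ f x) :
    ((∫ x in (0:ℝ)..1, x ^ 3 * f x ^ 2) - (∫ x in (0:ℝ)..1, x ^ 2 * f x ^ 3) ≤ 2 / 81) ∧
    ((∫ x in (0:ℝ)..1, x ^ 3 * ((2/3) * x) ^ 2) - (∫ x in (0:ℝ)..1, x ^ 2 * ((2/3) * x) ^ 3)
      = 2 / 81) := by
  constructor
  · have h₁ : IntervalIntegrable (fun x ↦ x ^ 3 * f x ^ 2) MeasureTheory.volume 0 1 :=
      ContinuousOn.intervalIntegrable_of_Icc zero_le_one (by fun_prop)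
    have h₂ : IntervalIntegrable (fun x ↦ x ^ 2 * f x ^ 3) MeasureTheory.volume 0 1 :=
      ContinuousOn.intervalIntegrable_of_Icc zero_le_one (by fun_prop)
    rw [← intervalIntegral.integral_sub h₁ h₂]
    calc ∫ x in (0:ℝ)..1, (x ^ 3 * f x ^ 2 - x ^ 2 * f x ^ 3)
        ≤ ∫ x in (0:ℝ)..1, 4 / 27 * x ^ 5 :=
          intervalIntegral.integral_mono_on zero_le_one (h₁.sub h₂)
            (Continuous.intervalIntegrable (by fun_prop) _ _)
            fun x hx ↦ cube_mul_sq_sub_sq_mul_cube_le hx.1 (hpos x hx)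
      _ = 2 / 81 := by
          rw [intervalIntegral.integral_const_mul, integral_pow]
          norm_num
  · have h₁ (x : ℝ) : x ^ 3 * ((2/3) * x) ^ 2 = 4 / 9 * x ^ 5 := by ring
    have h₂ (x : ℝ) : x ^ 2 * ((2/3) * x) ^ 3 = 8 / 27 * x ^ 5 := by ring
    simp only [h₁, h₂, intervalIntegral.integral_const_mul, integral_pow]
    norm_num
end

section
/- Let f : [0,∞) → ℝ be differentiable (one-sided differentiable at 0) with f(0) ≥ 0 and suppose f′(x) ≥ f(x)³ for all x ≥ 0. Then f(x) = 0 for every x ≥ 0. -/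
/-- A function on `[0, ∞)` with `f 0 ≥ 0` and `f' ≥ f ^ 3` stays nonnegative. -/
theorem nonneg_of_cube_le_deriv {f f' : ℝ → ℝ}
    (hderiv : ∀ x ∈ Set.Ici (0 : ℝ), HasDerivWithinAt f (f' x) (Set.Ici 0) x)
    (h0 : 0 ≤ f 0) (hineq : ∀ x ∈ Set.Ici (0 : ℝ), f x ^ 3 ≤ f' x) {T : ℝ} (hT : 0 ≤ T) :
    0 ≤ f T := by
  by_contra! hneg
  obtain ⟨δ, hδ, hδ1, hδf⟩ : ∃ δ : ℝ, 0 < δ ∧ δ < 1 ∧ δ < -f T := by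
    obtain ⟨δ, hδ, hlt⟩ := exists_between (lt_min one_pos (neg_pos.2 hneg))
    exact ⟨δ, hδ, hlt.trans_le (min_le_left _ _), hlt.trans_le (min_le_right _ _)⟩
  have hbarrier : -f T ≤ δ * Real.exp (T - T) := by
    refine image_le_of_deriv_right_lt_deriv_boundary (f := fun x => -f x) (f' := fun x => -f' x)
      (B := fun x => δ * Real.exp (x - T)) (B' := fun x => δ * Real.exp (x - T)) (a := 0) (b := T)
      ?_ ?_ ?_ ?_ ?_ (Set.right_mem_Icc.2 hT)
    · exact fun x hx => ((hderiv x hx.1).continuousWithinAt.mono Set.Icc_subset_Ici_self).neg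
    · exact fun x hx => ((hderiv x hx.1).mono (Set.Ici_subset_Ici.2 hx.1)).fun_neg
    · have := Real.exp_pos (0 - T)
      nlinarith
    · intro x
      simpa using (((hasDerivAt_id x).sub_const T).exp).const_mul δ
    · intro x hx heq
      have hexp : Real.exp (x - T) ≤ 1 := Real.exp_le_one_iff.2 (by linarith [hx.2])
      have hpos : 0 < δ * Real.exp (x - T) := by positivity
      have hlt : δ * Real.exp (x - T) < 1 := by nlinarith [Real.exp_pos (x - T)]
      have hcube := pow_lt_self_of_lt_one₀ hpos hlt (n := 3) (by norm_num)
      have := hineq x hx.1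
      rw [← heq] at hcube ⊢
      linarith [Odd.neg_pow (by decide : Odd 3) (f x)]
  simp only [sub_self, Real.exp_zero, mul_one] at hbarrier
  linarith

theorem stmt_3 (f f' : ℝ → ℝ)
    (hderiv : ∀ x ∈ Set.Ici (0 : ℝ), HasDerivWithinAt f (f' x) (Set.Ici 0) x)
    (h0 : 0 ≤ f 0)
    (hineq : ∀ x ∈ Set.Ici (0 : ℝ), f x ^ 3 ≤ f' x) :
    ∀ x ∈ Set.Ici (0 : ℝ), f x = 0 := by
  have hnonneg : ∀ x, 0 ≤ x → 0 ≤ f x := fun x => nonneg_of_cube_le_deriv hderiv h0 hineq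
  have hmono : MonotoneOn f (Set.Ici 0) :=
    monotoneOn_of_hasDerivWithinAt_nonneg (convex_Ici 0)
      (fun x hx => (hderiv x hx).continuousWithinAt)
      (fun x hx => (hderiv x (interior_subset hx)).mono interior_subset)
      (fun x hx => (pow_nonneg (hnonneg x (interior_subset hx)) 3).trans
        (hineq x (interior_subset hx)))
  intro a ha
  by_contra hne
  have ha0 : 0 ≤ a := ha
  have hpos : ∀ x, a ≤ x → 0 < f x := fun x hx =>
    ((hnonneg a ha0).lt_of_ne' hne).trans_le (hmono ha (ha0.trans hx) hx)
  have hd : ∀ x ∈ Set.Ici a, HasDerivWithinAt (fun y => (f y ^ 2)⁻¹ + 2 * y)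
      (-(2 * f x * f' x) / (f x ^ 2) ^ 2 + 2) (Set.Ici a) x := fun x hx => by
    have hf := (hderiv x (ha0.trans hx)).mono (Set.Ici_subset_Ici.2 ha0)
    simpa using ((hf.fun_pow 2).fun_inv (pow_pos (hpos x hx) 2).ne').fun_add
      ((hasDerivWithinAt_id x _).const_mul 2)
  have hanti : AntitoneOn (fun y => (f y ^ 2)⁻¹ + 2 * y) (Set.Ici a) := by
    refine antitoneOn_of_hasDerivWithinAt_nonpos (convex_Ici a)
      (fun x hx => (hd x hx).continuousWithinAt)
      (fun x hx => (hd x (interior_subset hx)).mono interior_subset) fun x hx => ?_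
    have hx' : a ≤ x := interior_subset hx
    have hfx := hpos x hx'
    have hle := mul_le_mul_of_nonneg_left (hineq x (ha0.trans hx')) hfx.le
    have : -(2 * f x * f' x) / (f x ^ 2) ^ 2 ≤ -2 := by
      rw [div_le_iff₀ (by positivity)]
      linarith
    linarith
  have hinv : 0 < (f a ^ 2)⁻¹ := inv_pos.2 (pow_pos (hpos a le_rfl) 2)
  have hb : a ≤ a + (f a ^ 2)⁻¹ := by linarith
  have hle := hanti Set.self_mem_Ici hb hb
  have := inv_pos.2 (pow_pos (hpos _ hb) 2)
  simp only at hle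
  linarith
end

section
/- ∫₀¹ (1/x)·( 6·(log(1+x))²·(log(1−x))² + (log(1+x))⁴ ) dx = (21/4)·ζ(5), where ζ is the Riemann zeta function. -/
open MeasureTheory Set

theorem summable_one_div_add_one_pow_five : Summable fun n : ℕ => 1 / ((n : ℝ) + 1) ^ 5 := by
  have := (summable_nat_add_iff 1).2 (Real.summable_one_div_nat_pow.2 (show 1 < 5 by norm_num))
  simpa using this

/-- The Bose integral `∫ t > 0, t⁴ / (eᵗ - 1) = 4! ζ(5)`. -/
theorem integral_pow_four_mul_exp_div_one_sub_exp :
    ∫ t in Ioi (0 : ℝ), t ^ 4 * (Real.exp (-t) / (1 - Real.exp (-t)))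
      = 24 * ∑' n : ℕ, 1 / ((n : ℝ) + 1) ^ 5 := by
  have hval (n : ℕ) : ∫ t in Ioi (0 : ℝ), t ^ 4 * Real.exp (-t) ^ (n + 1)
      = 24 * (1 / ((n : ℝ) + 1) ^ 5) := by
    have h := Real.integral_rpow_mul_exp_neg_mul_Ioi (a := 5) (r := (n : ℝ) + 1)
      (by norm_num) (by positivity)
    have hG : Real.Gamma 5 = 24 := by
      rw [show (5 : ℝ) = ((4 : ℕ) : ℝ) + 1 by norm_num, Real.Gamma_nat_eq_factorial]
      norm_num [Nat.factorial]
    rw [hG] at h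
    have h5 : (1 / ((n : ℝ) + 1)) ^ (5 : ℝ) * 24 = 24 * (1 / ((n : ℝ) + 1) ^ 5) := by
      rw [show (5 : ℝ) = ((5 : ℕ) : ℝ) by norm_num, Real.rpow_natCast, one_div_pow, mul_comm]
    rw [← h5, ← h]
    refine setIntegral_congr_fun measurableSet_Ioi fun t _ => ?_
    rw [← Real.exp_nat_mul, show (5 : ℝ) - 1 = ((4 : ℕ) : ℝ) by norm_num, Real.rpow_natCast]
    push_cast
    ring_nf
  have hint (n : ℕ) : IntegrableOn (fun t : ℝ => t ^ 4 * Real.exp (-t) ^ (n + 1)) (Ioi 0) := by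
    refine Integrable.of_integral_ne_zero ?_
    rw [hval n]
    positivity
  have key := hasSum_integral_of_summable_integral_norm hint (by
    have : (fun n : ℕ => ∫ t in Ioi (0 : ℝ), ‖t ^ 4 * Real.exp (-t) ^ (n + 1)‖)
        = fun n : ℕ => 24 * (1 / ((n : ℝ) + 1) ^ 5) := by
      funext n
      rw [← hval n]
      refine setIntegral_congr_fun measurableSet_Ioi fun t _ => ?_
      exact Real.norm_of_nonneg (by positivity)
    rw [this]
    exact summable_one_div_add_one_pow_five.mul_left 24)
  simp only [hval] at key
  rw [← tsum_mul_left, key.tsum_eq]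
  refine setIntegral_congr_fun measurableSet_Ioi fun t ht => ?_
  have h1 : Real.exp (-t) < 1 := Real.exp_lt_one_iff.2 (by simpa using ht)
  have := ((hasSum_geometric_of_lt_one (Real.exp_nonneg _) h1).mul_left
    (t ^ 4 * Real.exp (-t))).tsum_eq
  rw [div_eq_mul_inv, ← mul_assoc, ← this]
  congr 1
  funext n
  ring

theorem tsum_one_div_add_one_pow_five_pos : 0 < ∑' n : ℕ, 1 / ((n : ℝ) + 1) ^ 5 :=
  summable_one_div_add_one_pow_five.tsum_pos (fun n => by positivity) 0 (by norm_num)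

theorem integral_log_one_sub_pow_four_div :
    ∫ x in Ioo (0 : ℝ) 1, Real.log (1 - x) ^ 4 / x
      = 24 * ∑' n : ℕ, 1 / ((n : ℝ) + 1) ^ 5 := by
  have himg : (fun t : ℝ => 1 - Real.exp (-t)) '' Ioi 0 = Ioo 0 1 := by
    ext x
    constructor
    · rintro ⟨t, ht, rfl⟩
      have h1 : Real.exp (-t) < 1 := Real.exp_lt_one_iff.2 (by simpa using ht)
      exact ⟨by simpa using h1, by linarith [Real.exp_pos (-t)]⟩
    · rintro ⟨h0, h1⟩
      refine ⟨-Real.log (1 - x), ?_, ?_⟩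
      · simpa using Real.log_neg (by linarith) (by linarith)
      · simp [Real.exp_log (show 0 < 1 - x by linarith)]
  have hd (t : ℝ) (_ : t ∈ Ioi (0 : ℝ)) :
      HasDerivWithinAt (fun t : ℝ => 1 - Real.exp (-t)) (Real.exp (-t)) (Ioi 0) t := by
    have := ((hasDerivAt_neg t).exp.const_sub 1).hasDerivWithinAt (s := Ioi 0)
    simpa using this
  have hinj : InjOn (fun t : ℝ => 1 - Real.exp (-t)) (Ioi 0) := fun a _ b _ h => by
    simpa using h
  rw [← himg, integral_image_eq_integral_abs_deriv_smul measurableSet_Ioi hd hinj,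
    ← integral_pow_four_mul_exp_div_one_sub_exp]
  refine setIntegral_congr_fun measurableSet_Ioi fun t _ => ?_
  simp only [smul_eq_mul, abs_of_pos (Real.exp_pos (-t)), sub_sub_cancel, Real.log_exp]
  ring

theorem integral_log_one_sub_sq_pow_four_div :
    ∫ x in Ioo (0 : ℝ) 1, Real.log (1 - x ^ 2) ^ 4 / x
      = 12 * ∑' n : ℕ, 1 / ((n : ℝ) + 1) ^ 5 := by
  have himg : (fun x : ℝ => x ^ 2) '' Ioo 0 1 = Ioo 0 1 := by
    ext y
    constructor
    · rintro ⟨x, ⟨h0, h1⟩, rfl⟩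
      exact ⟨by positivity, by simpa using pow_lt_one₀ h0.le h1 two_ne_zero⟩
    · rintro ⟨h0, h1⟩
      exact ⟨√y, ⟨Real.sqrt_pos.2 h0, by rw [Real.sqrt_lt' one_pos]; simpa using h1⟩,
        Real.sq_sqrt h0.le⟩
  have hd (x : ℝ) (_ : x ∈ Ioo (0 : ℝ) 1) :
      HasDerivWithinAt (fun x : ℝ => x ^ 2) (2 * x) (Ioo 0 1) x := by
    simpa using (hasDerivAt_pow 2 x).hasDerivWithinAt (s := Ioo 0 1)
  have hinj : InjOn (fun x : ℝ => x ^ 2) (Ioo 0 1) := fun a ha b hb h =>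
    (pow_left_inj₀ ha.1.le hb.1.le two_ne_zero).1 h
  have h := integral_log_one_sub_pow_four_div
  rw [← himg, integral_image_eq_integral_abs_deriv_smul measurableSet_Ioo hd hinj] at h
  have h2 : ∫ x in Ioo (0 : ℝ) 1, |2 * x| • (Real.log (1 - x ^ 2) ^ 4 / x ^ 2)
      = ∫ x in Ioo (0 : ℝ) 1, 2 * (Real.log (1 - x ^ 2) ^ 4 / x) := by
    refine setIntegral_congr_fun measurableSet_Ioo fun x hx => ?_
    have h0 : 0 < x := hx.1
    simp only [smul_eq_mul, abs_of_pos (mul_pos two_pos h0)]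
    field_simp
  rw [h2, integral_const_mul] at h
  linarith

theorem integral_pow_four_mul_exp_div_one_sub_exp_two_mul :
    ∫ t in Ioi (0 : ℝ), t ^ 4 * (2 * Real.exp (-t) / (1 - Real.exp (-t) ^ 2))
      = (93 / 2) * ∑' n : ℕ, 1 / ((n : ℝ) + 1) ^ 5 := by
  have hpos := tsum_one_div_add_one_pow_five_pos
  have hK := integral_pow_four_mul_exp_div_one_sub_exp
  have hKint : IntegrableOn (fun t : ℝ => t ^ 4 * (Real.exp (-t) / (1 - Real.exp (-t))))
      (Ioi 0) := Integrable.of_integral_ne_zero (by rw [hK]; positivity)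
  have hS := integral_comp_mul_left_Ioi
    (fun t : ℝ => t ^ 4 * (Real.exp (-t) / (1 - Real.exp (-t)))) 0 (two_pos (α := ℝ))
  rw [mul_zero, hK] at hS
  have hSint : IntegrableOn
      (fun t : ℝ => (2 * t) ^ 4 * (Real.exp (-(2 * t)) / (1 - Real.exp (-(2 * t))))) (Ioi 0) :=
    Integrable.of_integral_ne_zero (by rw [hS]; simp only [smul_eq_mul]; positivity)
  have hsub := integral_sub (hKint.const_mul 2) (hSint.const_mul (1 / 8))
  rw [integral_const_mul, integral_const_mul, hK, hS, smul_eq_mul] at hsub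
  refine Eq.trans (setIntegral_congr_fun measurableSet_Ioi fun t ht => ?_)
    (hsub.trans (by ring))
  have h1 : Real.exp (-t) < 1 := Real.exp_lt_one_iff.2 (by simpa using ht)
  have h0 := Real.exp_pos (-t)
  have he : Real.exp (-(2 * t)) = Real.exp (-t) ^ 2 := by
    rw [← Real.exp_nat_mul]
    push_cast
    ring_nf
  simp only [he]
  generalize Real.exp (-t) = q at *
  have h2 : 1 - q ≠ 0 := by linarith
  have h3 : 1 + q ≠ 0 := by linarith
  rw [show 1 - q ^ 2 = (1 - q) * (1 + q) by ring]
  field_simp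
  ring

theorem integral_log_one_add_sub_log_one_sub_pow_four_div :
    ∫ x in Ioo (0 : ℝ) 1, (Real.log (1 + x) - Real.log (1 - x)) ^ 4 / x
      = (93 / 2) * ∑' n : ℕ, 1 / ((n : ℝ) + 1) ^ 5 := by
  have hlog (t : ℝ) (ht : t ∈ Ioi (0 : ℝ)) :
      Real.log (1 + (1 - Real.exp (-t)) / (1 + Real.exp (-t)))
        - Real.log (1 - (1 - Real.exp (-t)) / (1 + Real.exp (-t))) = t := by
    have h0 := Real.exp_pos (-t)
    have e1 : 1 + (1 - Real.exp (-t)) / (1 + Real.exp (-t)) = 2 / (1 + Real.exp (-t)) := by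
      field_simp; ring
    have e2 : 1 - (1 - Real.exp (-t)) / (1 + Real.exp (-t))
        = 2 / (1 + Real.exp (-t)) * Real.exp (-t) := by
      field_simp; ring
    rw [e2, e1, Real.log_mul (by positivity) h0.ne', Real.log_exp]
    ring
  have himg : (fun t : ℝ => (1 - Real.exp (-t)) / (1 + Real.exp (-t))) '' Ioi 0 = Ioo 0 1 := by
    ext x
    constructor
    · rintro ⟨t, ht, rfl⟩
      have h1 : Real.exp (-t) < 1 := Real.exp_lt_one_iff.2 (by simpa using ht)
      have h0 := Real.exp_pos (-t)
      exact ⟨div_pos (by linarith) (by linarith), by rw [div_lt_one (by linarith)]; linarith⟩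
    · rintro ⟨h0, h1⟩
      have hq : 0 < (1 - x) / (1 + x) := div_pos (by linarith) (by linarith)
      refine ⟨-Real.log ((1 - x) / (1 + x)), ?_, ?_⟩
      · simpa using Real.log_neg hq (by rw [div_lt_one (by linarith)]; linarith)
      · simp only [neg_neg, Real.exp_log hq]
        have : 1 + x ≠ 0 := by linarith
        field_simp
        ring
  have hd (t : ℝ) (_ : t ∈ Ioi (0 : ℝ)) :
      HasDerivWithinAt (fun t : ℝ => (1 - Real.exp (-t)) / (1 + Real.exp (-t)))
        (2 * Real.exp (-t) / (1 + Real.exp (-t)) ^ 2) (Ioi 0) t := by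
    have h0 := Real.exp_pos (-t)
    have he := (hasDerivAt_neg t).exp
    refine (((he.const_sub 1).div (he.const_add 1) (by positivity)).congr_deriv ?_).hasDerivWithinAt
    congr 1
    ring
  have hinj : InjOn (fun t : ℝ => (1 - Real.exp (-t)) / (1 + Real.exp (-t))) (Ioi 0) := by
    intro a ha b hb h
    beta_reduce at h
    rw [← hlog a ha, ← hlog b hb, h]
  rw [← himg, integral_image_eq_integral_abs_deriv_smul measurableSet_Ioi hd hinj,
    ← integral_pow_four_mul_exp_div_one_sub_exp_two_mul]
  refine setIntegral_congr_fun measurableSet_Ioi fun t ht => ?_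
  have h1 : Real.exp (-t) < 1 := Real.exp_lt_one_iff.2 (by simpa using ht)
  have h0 := Real.exp_pos (-t)
  simp only [hlog t ht, smul_eq_mul]
  rw [abs_of_pos (by positivity)]
  generalize Real.exp (-t) = q at *
  have h2 : 1 - q ≠ 0 := by linarith
  have h3 : 1 + q ≠ 0 := by linarith
  rw [show 1 - q ^ 2 = (1 - q) * (1 + q) by ring]
  field_simp

theorem stmt_4 :
    ∫ x in (0:ℝ)..1,
        (1 / x) * (6 * Real.log (1 + x) ^ 2 * Real.log (1 - x) ^ 2 + Real.log (1 + x) ^ 4)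
      = (21 / 4) * ∑' n : ℕ, 1 / ((n : ℝ) + 1) ^ 5 := by
  have hpos := tsum_one_div_add_one_pow_five_pos
  have hA := integral_log_one_sub_sq_pow_four_div
  have hB := integral_log_one_add_sub_log_one_sub_pow_four_div
  have hC := integral_log_one_sub_pow_four_div
  have iA : IntegrableOn (fun x : ℝ => Real.log (1 - x ^ 2) ^ 4 / x) (Ioo 0 1) :=
    Integrable.of_integral_ne_zero (by rw [hA]; positivity)
  have iB : IntegrableOn (fun x : ℝ => (Real.log (1 + x) - Real.log (1 - x)) ^ 4 / x) (Ioo 0 1) :=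
    Integrable.of_integral_ne_zero (by rw [hB]; positivity)
  have iC : IntegrableOn (fun x : ℝ => Real.log (1 - x) ^ 4 / x) (Ioo 0 1) :=
    Integrable.of_integral_ne_zero (by rw [hC]; positivity)
  have h := integral_sub ((iA.add iB).const_mul (1 / 2)) iC
  rw [integral_const_mul, integral_add' iA iB, hA, hB, hC] at h
  rw [intervalIntegral.integral_of_le zero_le_one, integral_Ioc_eq_integral_Ioo]
  refine Eq.trans (setIntegral_congr_fun measurableSet_Ioo fun x hx => ?_) (h.trans (by ring))
  have hlog : Real.log (1 - x ^ 2) = Real.log (1 + x) + Real.log (1 - x) := by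
    rw [← Real.log_mul (by linarith [hx.1]) (by linarith [hx.2])]
    ring_nf
  simp only [Pi.add_apply, hlog]
  ring
end

section
/- ∫₀^{π/2} tanh(tan²θ) / ( sin(2θ) · (1 + cosh(2·tan²θ)) ) dθ = 7·ζ(3)/(8π²), where ζ is the Riemann zeta function. -/
open MeasureTheory Set Filter Topology

theorem hasSum_coth_sub_inv {x : ℝ} (hx : 0 < x) :
    HasSum (fun n : ℕ => 2 * x / (x ^ 2 + ((n + 1) * Real.pi) ^ 2))
      (Real.cosh x / Real.sinh x - 1 / x) := by
  have hπ : (Real.pi : ℂ) ≠ 0 := by exact_mod_cast Real.pi_ne_zero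
  have hxc : (x : ℂ) ≠ 0 := by exact_mod_cast hx.ne'
  set z : ℂ := x * Complex.I / Real.pi with hzdef
  have hzim : z.im = x / Real.pi := by
    have : z = ((x / Real.pi : ℝ) : ℂ) * Complex.I := by rw [hzdef]; push_cast; ring
    rw [this, Complex.im_ofReal_mul, Complex.I_im, mul_one]
  have hz : z ∈ Complex.integerComplement := by
    rintro ⟨n, hn⟩
    have h := congrArg Complex.im hn
    rw [hzim, Complex.intCast_im] at h
    exact (div_pos hx Real.pi_pos).ne h
  have hπz : (Real.pi : ℂ) * z = x * Complex.I := by rw [hzdef]; field_simp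
  have hs : Complex.sinh x ≠ 0 := by
    rw [← Complex.ofReal_sinh]; exact_mod_cast (Real.sinh_pos_iff.2 hx).ne'
  have hsum : HasSum (fun n : ℕ => 1 / (z - (n + 1)) + 1 / (z + (n + 1)))
      (Real.pi * Complex.cot (Real.pi * z) - 1 / z) := by
    rw [cot_series_rep' hz]
    exact (summable_cotTerm hz).hasSum
  have hsum' := hsum.mul_left (Complex.I / Real.pi)
  rw [← Complex.hasSum_ofReal]
  convert! hsum' using 1
  · funext n
    have h1 : z - (n + 1) ≠ 0 := fun h => hz ⟨n + 1, by push_cast; linear_combination -h⟩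
    have h2 : z + (n + 1) ≠ 0 := fun h => hz ⟨-(n + 1), by push_cast; linear_combination -h⟩
    have h3 : (x : ℂ) ^ 2 + ((n + 1) * Real.pi) ^ 2 ≠ 0 := by
      have : (0 : ℝ) < x ^ 2 + ((n + 1) * Real.pi) ^ 2 := by positivity
      exact_mod_cast this.ne'
    push_cast
    have h4 : (z - (n + 1)) * (z + (n + 1)) * Real.pi ^ 2
        = -((x : ℂ) ^ 2 + ((n + 1) * Real.pi) ^ 2) := by
      rw [hzdef]; field_simp; linear_combination (x : ℂ) ^ 2 * Complex.I_sq
    rw [div_add_div _ _ h1 h2, div_mul_div_comm, div_eq_div_iff h3 (by positivity)]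
    linear_combination (-2 * Complex.I * z) * h4
      + (2 * Real.pi * ((z - (n + 1)) * (z + (n + 1))) * Complex.I) * hπz
      + (2 * Real.pi * ((z - (n + 1)) * (z + (n + 1))) * x) * Complex.I_sq
  · rw [hπz, Complex.cot_eq_cos_div_sin, Complex.cos_mul_I, Complex.sin_mul_I, hzdef]
    push_cast
    field_simp

theorem hasSum_tanh_div {x : ℝ} (hx : 0 < x) :
    HasSum (fun k : ℕ => 2 / (x ^ 2 + ((2 * k + 1) * Real.pi / 2) ^ 2)) (Real.tanh x / x) := by
  have h1 := hasSum_coth_sub_inv hx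
  have h2 := (hasSum_coth_sub_inv (x := 2 * x) (by positivity)).mul_left 2
  set h : ℕ → ℝ := fun n => 2 * (2 * (2 * x) / ((2 * x) ^ 2 + ((n + 1) * Real.pi) ^ 2)) with hh
  have he : Summable fun k : ℕ => h (2 * k) :=
    h2.summable.comp_injective (fun a b hab => by simpa using hab)
  have ho : HasSum (fun k : ℕ => h (2 * k + 1)) (Real.cosh x / Real.sinh x - 1 / x) := by
    convert! h1 using 2 with k
    simp only [hh]
    push_cast
    have : (0 : ℝ) < x ^ 2 + ((k + 1) * Real.pi) ^ 2 := by positivity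
    have h' : (2 * x) ^ 2 + ((2 * (k : ℝ) + 1 + 1) * Real.pi) ^ 2
      = 4 * (x ^ 2 + ((k + 1) * Real.pi) ^ 2) := by ring
    rw [h']
    field_simp
    norm_num
  have hu := (he.hasSum.even_add_odd ho).unique h2
  have hs := (Real.sinh_pos_iff.2 hx).ne'
  have hc := (Real.cosh_pos x).ne'
  have hv : ∑' k : ℕ, h (2 * k) = Real.tanh x := by
    rw [eq_sub_of_add_eq hu, Real.tanh_eq_sinh_div_cosh, Real.cosh_two_mul, Real.sinh_two_mul]
    field_simp
    ring
  have hfin := he.hasSum.div_const x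
  rw [hv] at hfin
  convert! hfin using 2 with k
  simp only [hh]
  push_cast
  have : (0 : ℝ) < x ^ 2 + ((2 * k + 1) * Real.pi / 2) ^ 2 := by positivity
  have h' : (2 * x) ^ 2 + ((2 * (k : ℝ) + 1) * Real.pi) ^ 2
      = 4 * (x ^ 2 + ((2 * k + 1) * Real.pi / 2) ^ 2) := by ring
  rw [h']
  field_simp
  norm_num

theorem lintegral_Ioi_ofReal_of_hasDerivAt {g g' : ℝ → ℝ} {a l : ℝ}
    (hderiv : ∀ x ∈ Ici a, HasDerivAt g (g' x) x) (g'pos : ∀ x ∈ Ioi a, 0 ≤ g' x)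
    (hg : Tendsto g atTop (𝓝 l)) :
    ∫⁻ x in Ioi a, ENNReal.ofReal (g' x) = ENNReal.ofReal (l - g a) := by
  rw [← integral_Ioi_of_hasDerivAt_of_nonneg' hderiv g'pos hg,
    ofReal_integral_eq_lintegral_ofReal (integrableOn_Ioi_deriv_of_nonneg' hderiv g'pos hg)]
  exact (ae_restrict_iff' measurableSet_Ioi).2 (ae_of_all _ g'pos)

theorem hasDerivAt_arctan_div {a : ℝ} (ha : 0 < a) (x : ℝ) :
    HasDerivAt (fun x => Real.arctan (x / a) / a) (1 / (x ^ 2 + a ^ 2)) x := by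
  have h := (((hasDerivAt_id x).div_const a).arctan).div_const a
  convert! h using 1
  simp only [id]
  field_simp
  ring

theorem tendsto_arctan_div_atTop {a : ℝ} (ha : 0 < a) :
    Tendsto (fun x => Real.arctan (x / a) / a) atTop (𝓝 (Real.pi / 2 / a)) :=
  (((Real.tendsto_arctan_atTop).mono_right nhdsWithin_le_nhds).comp
    (tendsto_id.atTop_div_const ha)).div_const a

theorem lintegral_inv_mul_inv_sq_add_sq {a b : ℝ} (ha : 0 < a) (hb : 0 < b) :
    ∫⁻ x in Ioi (0 : ℝ), ENNReal.ofReal (1 / ((x ^ 2 + a ^ 2) * (x ^ 2 + b ^ 2)))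
      = ENNReal.ofReal (Real.pi / (2 * a * b * (a + b))) := by
  rcases eq_or_ne a b with rfl | hab
  · have hderiv (x : ℝ) : HasDerivAt
        (fun x => (x / (x ^ 2 + a ^ 2) + Real.arctan (x / a) / a) / (2 * a ^ 2))
        (1 / ((x ^ 2 + a ^ 2) * (x ^ 2 + a ^ 2))) x := by
      have hp : x ^ 2 + a ^ 2 ≠ 0 := by positivity
      have h := ((((hasDerivAt_id x).div (((hasDerivAt_id x).pow 2).add_const (a ^ 2)) hp).add
        (hasDerivAt_arctan_div ha x))).div_const (2 * a ^ 2)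
      convert! h using 1
      simp
      field_simp
      ring
    have hlim : Tendsto (fun x : ℝ => x / (x ^ 2 + a ^ 2)) atTop (𝓝 0) := by
      refine squeeze_zero' (g := fun x => x⁻¹) ?_ ?_ tendsto_inv_atTop_zero
      · filter_upwards [eventually_ge_atTop 0] with x hx
        positivity
      · filter_upwards [eventually_gt_atTop 0] with x hx
        rw [div_le_iff₀ (by positivity)]
        field_simp
        nlinarith [sq_nonneg a]
    rw [lintegral_Ioi_ofReal_of_hasDerivAt (fun x _ => hderiv x) (fun x _ => by positivity)
      ((hlim.add (tendsto_arctan_div_atTop ha)).div_const _)]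
    congr 1
    simp
    field_simp
    norm_num
  · have hd : b ^ 2 - a ^ 2 ≠ 0 := by
      rw [sq_sub_sq]
      exact mul_ne_zero (by positivity) (sub_ne_zero.2 hab.symm)
    have hderiv (x : ℝ) : HasDerivAt
        (fun x => (Real.arctan (x / a) / a - Real.arctan (x / b) / b) / (b ^ 2 - a ^ 2))
        (1 / ((x ^ 2 + a ^ 2) * (x ^ 2 + b ^ 2))) x := by
      have h := ((hasDerivAt_arctan_div ha x).sub
        (hasDerivAt_arctan_div hb x)).div_const (b ^ 2 - a ^ 2)
      convert! h using 1
      field_simp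
      ring
    rw [lintegral_Ioi_ofReal_of_hasDerivAt (fun x _ => hderiv x) (fun x _ => by positivity)
      (((tendsto_arctan_div_atTop ha).sub (tendsto_arctan_div_atTop hb)).div_const _)]
    congr 1
    have : b - a ≠ 0 := sub_ne_zero.2 hab.symm
    rw [sq_sub_sq] at hd ⊢
    simp
    field_simp
    ring

theorem hasDerivAt_tanh (x : ℝ) : HasDerivAt Real.tanh (1 / Real.cosh x ^ 2) x := by
  have h := (Real.hasDerivAt_sinh x).div (Real.hasDerivAt_cosh x) (Real.cosh_pos x).ne'
  have hf : Real.tanh = fun x => Real.sinh x / Real.cosh x := funext Real.tanh_eq_sinh_div_cosh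
  rw [hf]
  convert! h using 1
  rw [← Real.cosh_sq_sub_sinh_sq x]
  ring

theorem hasSum_artanh {x : ℝ} (hx : x ∈ Ioo (0 : ℝ) 1) :
    HasSum (fun k : ℕ => x ^ (2 * k + 1) / (2 * k + 1)) (Real.artanh x) := by
  have h := (Real.hasSum_log_sub_log_of_abs_lt_one (x := x)
    (abs_lt.2 ⟨by linarith [hx.1], hx.2⟩)).div_const 2
  rw [← Real.log_div (by linarith [hx.1]) (by linarith [hx.2])] at h
  rw [Real.artanh_eq_half_log ⟨by linarith [hx.1], hx.2.le⟩]
  convert! h using 1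
  · ext k; ring
  · ring

theorem tanh_image_Ioi : Real.tanh '' Ioi 0 = Ioo 0 1 := by
  ext y
  constructor
  · rintro ⟨x, hx, rfl⟩
    refine ⟨?_, Real.tanh_lt_one x⟩
    rw [Real.tanh_eq_sinh_div_cosh]
    exact div_pos (Real.sinh_pos_iff.2 hx) (Real.cosh_pos x)
  · intro hy
    exact ⟨Real.artanh y, Real.artanh_pos hy, Real.tanh_artanh ⟨by linarith [hy.1], hy.2⟩⟩

theorem lintegral_sq_mul_exp_neg {r : ℝ} (hr : 0 < r) :
    ∫⁻ t in Ioi (0 : ℝ), ENNReal.ofReal (t ^ 2 * Real.exp (-(r * t)))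
      = ENNReal.ofReal (2 / r ^ 3) := by
  have h : ∫ t in Ioi (0 : ℝ), t ^ 2 * Real.exp (-(r * t)) = 2 / r ^ 3 := by
    have h3 := Real.integral_rpow_mul_exp_neg_mul_Ioi (a := 3) (by norm_num) hr
    have hΓ : Real.Gamma 3 = 2 := by
      rw [show (3 : ℝ) = (2 : ℕ) + 1 by norm_num, Real.Gamma_nat_eq_factorial]
      norm_num
    rw [hΓ, show (3 : ℝ) - 1 = (2 : ℕ) by norm_num, show (3 : ℝ) = (3 : ℕ) by norm_num] at h3
    simp only [Real.rpow_natCast] at h3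
    rw [h3]
    field_simp
  rw [← h, ofReal_integral_eq_lintegral_ofReal (.of_integral_ne_zero (h ▸ by positivity))]
  exact ae_of_all _ fun t => by positivity

theorem lintegral_artanh_sq_div :
    ∫⁻ x in Ioo (0 : ℝ) 1, ENNReal.ofReal (Real.artanh x ^ 2 / x)
      = ∑' k : ℕ, ENNReal.ofReal (1 / (2 * k + 1) ^ 3) := by
  rw [← tanh_image_Ioi, lintegral_image_eq_lintegral_abs_deriv_mul measurableSet_Ioi
    (fun x _ => (hasDerivAt_tanh x).hasDerivWithinAt) Real.tanh_injective.injOn]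
  have key : ∀ t ∈ Ioi (0 : ℝ), ENNReal.ofReal |1 / Real.cosh t ^ 2| *
      ENNReal.ofReal (Real.artanh (Real.tanh t) ^ 2 / Real.tanh t)
      = ∑' k : ℕ, ENNReal.ofReal (4 * (t ^ 2 * Real.exp (-((2 * (2 * k + 1)) * t)))) := by
    intro t ht
    have ht : 0 < t := ht
    have hs := (Real.sinh_pos_iff.2 ht)
    have hc := (Real.cosh_pos t)
    rw [← ENNReal.ofReal_mul (abs_nonneg _), Real.artanh_tanh, abs_of_nonneg (by positivity)]
    have hlt : Real.exp (-(4 * t)) < 1 := Real.exp_lt_one_iff.2 (by linarith)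
    have hsum := (hasSum_geometric_of_lt_one (Real.exp_pos (-(4 * t))).le hlt).mul_left
      (4 * t ^ 2 * Real.exp (-(2 * t)))
    have hterm (k : ℕ) : 4 * (t ^ 2 * Real.exp (-((2 * (2 * k + 1)) * t)))
        = 4 * t ^ 2 * Real.exp (-(2 * t)) * Real.exp (-(4 * t)) ^ k := by
      rw [← Real.exp_nat_mul, mul_assoc (4 * t ^ 2), ← Real.exp_add]
      ring_nf
    simp_rw [← hterm] at hsum
    rw [← ENNReal.ofReal_tsum_of_nonneg (fun k => by positivity) hsum.summable, hsum.tsum_eq]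
    congr 1
    have h2 : Real.sinh t * Real.cosh t * (4 * Real.exp (-(2 * t))) = 1 - Real.exp (-(4 * t)) := by
      rw [Real.sinh_eq, Real.cosh_eq, Real.exp_neg t, Real.exp_neg, Real.exp_neg,
        show 2 * t = t + t by ring, show 4 * t = t + t + (t + t) by ring]
      simp only [Real.exp_add]
      field_simp
      ring
    rw [← h2, Real.tanh_eq_sinh_div_cosh]
    field_simp
  rw [setLIntegral_congr_fun measurableSet_Ioi key, lintegral_tsum (by fun_prop)]
  congr with k
  simp_rw [ENNReal.ofReal_mul (show (0 : ℝ) ≤ 4 by norm_num)]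
  rw [lintegral_const_mul _ (by fun_prop), lintegral_sq_mul_exp_neg (by positivity),
    ← ENNReal.ofReal_mul (by norm_num)]
  congr 1
  field_simp
  norm_num

theorem lintegral_pow_Ioo (n : ℕ) :
    ∫⁻ x in Ioo (0 : ℝ) 1, ENNReal.ofReal (x ^ n) = ENNReal.ofReal (1 / (n + 1)) := by
  rw [← ofReal_integral_eq_lintegral_ofReal, ← integral_Ioc_eq_integral_Ioo,
    ← intervalIntegral.integral_of_le zero_le_one, integral_pow]
  · simp
  · exact ((continuous_pow n).integrableOn_Icc (a := (0 : ℝ)) (b := 1)).mono_set Ioo_subset_Icc_self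
  · exact (ae_restrict_iff' measurableSet_Ioo).2 (ae_of_all _ fun x hx => pow_nonneg hx.1.le n)

theorem tsum_tsum_odd :
    ∑' j : ℕ, ∑' k : ℕ,
      ENNReal.ofReal (1 / ((2 * j + 1) * (2 * k + 1) * (2 * j + 1 + (2 * k + 1))))
      = ∑' k : ℕ, ENNReal.ofReal (1 / (2 * k + 1) ^ 3) := by
  rw [← lintegral_artanh_sq_div]
  have key : ∀ x ∈ Ioo (0 : ℝ) 1, ENNReal.ofReal (Real.artanh x ^ 2 / x)
      = ∑' j : ℕ, ∑' k : ℕ, ENNReal.ofReal (1 / ((2 * j + 1) * (2 * k + 1)))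
        * ENNReal.ofReal (x ^ (2 * j + 1 + 2 * k)) := by
    intro x hx
    have h := hasSum_artanh hx
    have hx0 := hx.1
    have ha := Real.artanh_nonneg hx0.le
    have h' : ENNReal.ofReal (Real.artanh x)
        = ∑' k : ℕ, ENNReal.ofReal (x ^ (2 * k + 1) / (2 * k + 1)) := by
      rw [← h.tsum_eq, ENNReal.ofReal_tsum_of_nonneg (fun k => by positivity) h.summable]
    rw [div_eq_mul_inv, sq, ENNReal.ofReal_mul (by positivity), ENNReal.ofReal_mul ha]
    nth_rw 1 [h']
    rw [mul_assoc, ← ENNReal.tsum_mul_right]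
    congr with j
    rw [h', ← ENNReal.tsum_mul_right, ← ENNReal.tsum_mul_left]
    congr with k
    rw [← ENNReal.ofReal_mul (by positivity), ← ENNReal.ofReal_mul (by positivity),
      ← ENNReal.ofReal_mul (by positivity)]
    congr 1
    field_simp
    ring
  rw [setLIntegral_congr_fun measurableSet_Ioo key,
    lintegral_tsum (fun j => (Measurable.tsum fun k => by fun_prop).aemeasurable)]
  congr with j
  rw [lintegral_tsum (by fun_prop)]
  congr with k
  rw [lintegral_const_mul _ (by fun_prop), lintegral_pow_Ioo, ← ENNReal.ofReal_mul (by positivity)]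
  congr 1
  push_cast
  field_simp
  ring

theorem hasSum_one_div_odd_cube :
    HasSum (fun k : ℕ => 1 / (2 * (k : ℝ) + 1) ^ 3)
      (7 / 8 * ∑' n : ℕ, 1 / ((n : ℝ) + 1) ^ 3) := by
  have hs : Summable fun n : ℕ => 1 / ((n : ℝ) + 1) ^ 3 := by
    exact_mod_cast (summable_nat_add_iff 1).2 (Real.summable_one_div_nat_pow.2 (by norm_num : 1 < 3))
  have he : Summable fun k : ℕ => 1 / (((2 * k : ℕ) : ℝ) + 1) ^ 3 :=
    hs.comp_injective (i := fun k : ℕ => 2 * k) fun a b hab => by simpa using hab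
  have ho : HasSum (fun k : ℕ => 1 / (((2 * k + 1 : ℕ) : ℝ) + 1) ^ 3)
      (1 / 8 * ∑' n : ℕ, 1 / ((n : ℝ) + 1) ^ 3) := by
    convert! hs.hasSum.mul_left (1 / 8) using 2 with k
    push_cast
    rw [show 2 * (k : ℝ) + 1 + 1 = 2 * (k + 1) by ring]
    field_simp
    norm_num
  have hu := (he.hasSum.even_add_odd (f := fun n : ℕ => 1 / ((n : ℝ) + 1) ^ 3) ho).unique hs.hasSum
  have h := he.hasSum
  rw [eq_sub_of_add_eq hu] at h
  convert! h using 1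
  · push_cast
    rfl
  · ring

theorem lintegral_tanh_div_sq :
    ∫⁻ x in Ioi (0 : ℝ), ENNReal.ofReal ((Real.tanh x / x) ^ 2)
      = ENNReal.ofReal (14 * (∑' n : ℕ, 1 / ((n : ℝ) + 1) ^ 3) / Real.pi ^ 2) := by
  have key : ∀ x ∈ Ioi (0 : ℝ), ENNReal.ofReal ((Real.tanh x / x) ^ 2)
      = ∑' j : ℕ, ∑' k : ℕ, ENNReal.ofReal 4 * ENNReal.ofReal (1 /
        ((x ^ 2 + ((2 * j + 1) * Real.pi / 2) ^ 2) *
          (x ^ 2 + ((2 * k + 1) * Real.pi / 2) ^ 2))) := by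
    intro x hx
    have hx0 : 0 < x := hx
    have h := hasSum_tanh_div hx0
    have ha : 0 ≤ Real.tanh x / x := h.nonneg fun k => by positivity
    have h' : ENNReal.ofReal (Real.tanh x / x)
        = ∑' k : ℕ, ENNReal.ofReal (2 / (x ^ 2 + ((2 * k + 1) * Real.pi / 2) ^ 2)) := by
      rw [← h.tsum_eq, ENNReal.ofReal_tsum_of_nonneg (fun k => by positivity) h.summable]
    rw [sq, ENNReal.ofReal_mul ha]
    nth_rw 1 [h']
    rw [← ENNReal.tsum_mul_right]
    congr with j
    rw [h', ← ENNReal.tsum_mul_left]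
    congr with k
    rw [← ENNReal.ofReal_mul (by positivity), ← ENNReal.ofReal_mul (by positivity)]
    congr 1
    field_simp
    norm_num
  rw [setLIntegral_congr_fun measurableSet_Ioi key,
    lintegral_tsum (fun j => (Measurable.tsum fun k => by fun_prop).aemeasurable)]
  have hterm (j k : ℕ) : ∫⁻ x in Ioi (0 : ℝ), ENNReal.ofReal 4 * ENNReal.ofReal (1 /
        ((x ^ 2 + ((2 * j + 1) * Real.pi / 2) ^ 2) *
          (x ^ 2 + ((2 * k + 1) * Real.pi / 2) ^ 2)))
      = ENNReal.ofReal (16 / Real.pi ^ 2) * ENNReal.ofReal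
        (1 / ((2 * j + 1) * (2 * k + 1) * (2 * j + 1 + (2 * k + 1)))) := by
    rw [lintegral_const_mul _ (by fun_prop),
      lintegral_inv_mul_inv_sq_add_sq (by positivity) (by positivity),
      ← ENNReal.ofReal_mul (by positivity), ← ENNReal.ofReal_mul (by positivity)]
    congr 1
    field_simp
    norm_num
  have hsum (j : ℕ) : ∫⁻ x in Ioi (0 : ℝ), ∑' k : ℕ, ENNReal.ofReal 4 * ENNReal.ofReal (1 /
        ((x ^ 2 + ((2 * j + 1) * Real.pi / 2) ^ 2) *
          (x ^ 2 + ((2 * k + 1) * Real.pi / 2) ^ 2)))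
      = ENNReal.ofReal (16 / Real.pi ^ 2) * ∑' k : ℕ, ENNReal.ofReal
        (1 / ((2 * j + 1) * (2 * k + 1) * (2 * j + 1 + (2 * k + 1)))) := by
    rw [lintegral_tsum (by fun_prop), ← ENNReal.tsum_mul_left]
    exact tsum_congr (hterm j)
  rw [tsum_congr hsum, ENNReal.tsum_mul_left, tsum_tsum_odd,
    ← ENNReal.ofReal_tsum_of_nonneg (fun k => by positivity) hasSum_one_div_odd_cube.summable,
    hasSum_one_div_odd_cube.tsum_eq, ← ENNReal.ofReal_mul (by positivity)]
  congr 1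
  ring

theorem tanh_le_self {x : ℝ} (hx : 0 ≤ x) : Real.tanh x ≤ x := by
  have hd (y : ℝ) : HasDerivAt (fun y => y - Real.tanh y) (1 - 1 / Real.cosh y ^ 2) y :=
    (hasDerivAt_id y).sub (hasDerivAt_tanh y)
  have hm : Monotone fun y => y - Real.tanh y := by
    refine monotone_of_deriv_nonneg (fun y => (hd y).differentiableAt) fun y => ?_
    rw [(hd y).deriv, sub_nonneg, div_le_one (by positivity)]
    exact one_le_pow₀ (Real.one_le_cosh y)
  simpa using hm hx

theorem tanh_nonneg {x : ℝ} (hx : 0 ≤ x) : 0 ≤ Real.tanh x := by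
  rw [Real.tanh_eq_sinh_div_cosh]
  exact div_nonneg (Real.sinh_nonneg_iff.2 hx) (Real.cosh_pos x).le

theorem continuous_tanh : Continuous Real.tanh :=
  continuous_iff_continuousAt.2 fun x => (hasDerivAt_tanh x).continuousAt

theorem tendsto_tanh_atTop : Tendsto Real.tanh atTop (𝓝 1) := by
  have h (x : ℝ) : Real.tanh x = 1 - Real.exp (-x) / Real.cosh x := by
    have := (Real.cosh_pos x).ne'
    rw [Real.tanh_eq_sinh_div_cosh, eq_sub_iff_add_eq, ← add_div, div_eq_one_iff_eq this,
      Real.sinh_eq, Real.cosh_eq]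
    ring
  have h0 : Tendsto (fun x => Real.exp (-x) / Real.cosh x) atTop (𝓝 0) :=
    squeeze_zero (fun x => by positivity)
      (fun x => div_le_self (Real.exp_pos _).le (Real.one_le_cosh x))
      Real.tendsto_exp_neg_atTop_nhds_zero
  simpa [funext h] using h0.const_sub 1

theorem integral_tanh_div_mul_cosh_sq :
    ∫ x in Ioi (0 : ℝ), Real.tanh x / (x * Real.cosh x ^ 2)
      = 7 * (∑' n : ℕ, 1 / ((n : ℝ) + 1) ^ 3) / Real.pi ^ 2 := by
  have hcosh (x : ℝ) : 0 < Real.cosh x := Real.cosh_pos x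
  have hζ : 0 ≤ ∑' n : ℕ, 1 / ((n : ℝ) + 1) ^ 3 := tsum_nonneg fun n => by positivity
  have hsq : IntegrableOn (fun x => (Real.tanh x / x) ^ 2) (Ioi 0) := by
    refine ⟨(continuous_tanh.measurable.div measurable_id).pow_const 2 |>.aestronglyMeasurable, ?_⟩
    rw [hasFiniteIntegral_iff_ofReal (ae_of_all _ fun x => sq_nonneg _), lintegral_tanh_div_sq]
    exact ENNReal.ofReal_lt_top
  have hval : ∫ x in Ioi (0 : ℝ), (Real.tanh x / x) ^ 2
      = 14 * (∑' n : ℕ, 1 / ((n : ℝ) + 1) ^ 3) / Real.pi ^ 2 := by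
    rw [integral_eq_lintegral_of_nonneg_ae (ae_of_all _ fun x => sq_nonneg _)
      hsq.aestronglyMeasurable, lintegral_tanh_div_sq, ENNReal.toReal_ofReal (by positivity)]
  have hsech : IntegrableOn (fun x => 1 / Real.cosh x ^ 2) (Ioi 0) :=
    integrableOn_Ioi_deriv_of_nonneg' (fun x _ => hasDerivAt_tanh x) (fun x _ => by positivity)
      tendsto_tanh_atTop
  have hint : IntegrableOn (fun x => Real.tanh x / (x * Real.cosh x ^ 2)) (Ioi 0) := by
    refine hsech.mono' (continuous_tanh.measurable.div
      (measurable_id.mul (Real.measurable_cosh.pow_const 2))).aestronglyMeasurable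
      ((ae_restrict_iff' measurableSet_Ioi).2 (ae_of_all _ fun x hx => ?_))
    have hx : 0 < x := hx
    have := hcosh x
    rw [Real.norm_of_nonneg (div_nonneg (tanh_nonneg hx.le) (by positivity)),
      div_le_div_iff₀ (by positivity) (by positivity)]
    nlinarith [mul_le_mul_of_nonneg_right (tanh_le_self hx.le) (sq_nonneg (Real.cosh x))]
  have hderiv : ∀ x ∈ Ioi (0 : ℝ), HasDerivAt (fun x => Real.tanh x ^ 2 / x)
      (2 * (Real.tanh x / (x * Real.cosh x ^ 2)) - (Real.tanh x / x) ^ 2) x := by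
    intro x hx
    have hx : x ≠ 0 := ne_of_gt hx
    have := hcosh x
    convert! ((hasDerivAt_tanh x).pow 2).div (hasDerivAt_id x) hx using 1
    simp
    field_simp
  have hcont : ContinuousWithinAt (fun x => Real.tanh x ^ 2 / x) (Ici 0) 0 := by
    rw [ContinuousWithinAt, Real.tanh_zero, div_zero]
    refine squeeze_zero' (g := fun x => x) ?_ ?_ (tendsto_id.mono_left nhdsWithin_le_nhds)
    · filter_upwards [self_mem_nhdsWithin] with x (hx : 0 ≤ x)
      positivity
    · filter_upwards [self_mem_nhdsWithin] with x (hx : 0 ≤ x)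
      refine div_le_of_le_mul₀ hx hx ?_
      nlinarith [tanh_le_self hx, tanh_nonneg hx]
  have hlim : Tendsto (fun x => Real.tanh x ^ 2 / x) atTop (𝓝 0) :=
    (tendsto_tanh_atTop.pow 2).div_atTop tendsto_id
  have h := integral_Ioi_of_hasDerivAt_of_tendsto hcont hderiv ((hint.const_mul 2).sub hsq) hlim
  rw [integral_sub (hint.const_mul 2) hsq, integral_const_mul, hval] at h
  simp only [Real.tanh_zero, div_zero, sub_zero] at h
  linear_combination h / 2

theorem tan_sq_image_Ioo : (fun θ => Real.tan θ ^ 2) '' Ioo 0 (Real.pi / 2) = Ioi 0 := by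
  ext y
  constructor
  · rintro ⟨θ, hθ, rfl⟩
    exact pow_pos (Real.tan_pos_of_pos_of_lt_pi_div_two hθ.1 hθ.2) 2
  · intro (hy : 0 < y)
    refine ⟨Real.arctan √y, ⟨Real.arctan_pos.2 (Real.sqrt_pos.2 hy),
      Real.arctan_lt_pi_div_two _⟩, ?_⟩
    simp [Real.tan_arctan, Real.sq_sqrt hy.le]

theorem injOn_tan_sq : InjOn (fun θ => Real.tan θ ^ 2) (Ioo 0 (Real.pi / 2)) := by
  intro x hx y hy hxy
  have hxy' := (pow_left_inj₀ (Real.tan_pos_of_pos_of_lt_pi_div_two hx.1 hx.2).le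
    (Real.tan_pos_of_pos_of_lt_pi_div_two hy.1 hy.2).le two_ne_zero).1 hxy
  exact Real.tan_inj_of_lt_of_lt_pi_div_two (by linarith [hx.1, Real.pi_pos]) hx.2
    (by linarith [hy.1, Real.pi_pos]) hy.2 hxy'

theorem stmt_5 :
    ∫ θ in (0:ℝ)..(Real.pi / 2),
        Real.tanh (Real.tan θ ^ 2) /
          (Real.sin (2 * θ) * (1 + Real.cosh (2 * Real.tan θ ^ 2)))
      = 7 * (∑' n : ℕ, 1 / ((n : ℝ) + 1) ^ 3) / (8 * Real.pi ^ 2) := by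
  have hcos : ∀ θ ∈ Ioo 0 (Real.pi / 2), 0 < Real.cos θ := fun θ hθ =>
    Real.cos_pos_of_mem_Ioo ⟨by linarith [hθ.1, Real.pi_pos], hθ.2⟩
  have hderiv : ∀ θ ∈ Ioo 0 (Real.pi / 2), HasDerivWithinAt (fun θ => Real.tan θ ^ 2)
      (2 * Real.tan θ / Real.cos θ ^ 2) (Ioo 0 (Real.pi / 2)) θ := by
    intro θ hθ
    refine (((Real.hasDerivAt_tan (hcos θ hθ).ne').pow 2).congr_deriv ?_).hasDerivWithinAt
    push_cast
    ring
  have hsub := integral_image_eq_integral_abs_deriv_smul measurableSet_Ioo hderiv injOn_tan_sq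
    fun x => Real.tanh x / (x * Real.cosh x ^ 2)
  rw [tan_sq_image_Ioo, integral_tanh_div_mul_cosh_sq] at hsub
  rw [intervalIntegral.integral_of_le (by positivity), integral_Ioc_eq_integral_Ioo]
  have hpt : ∀ θ ∈ Ioo 0 (Real.pi / 2), Real.tanh (Real.tan θ ^ 2) /
      (Real.sin (2 * θ) * (1 + Real.cosh (2 * Real.tan θ ^ 2))) =
      1 / 8 * (|2 * Real.tan θ / Real.cos θ ^ 2| •
        (Real.tanh (Real.tan θ ^ 2) / (Real.tan θ ^ 2 * Real.cosh (Real.tan θ ^ 2) ^ 2))) := by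
    intro θ hθ
    have hc := hcos θ hθ
    have ht := Real.tan_pos_of_pos_of_lt_pi_div_two hθ.1 hθ.2
    have hC := Real.cosh_pos (Real.tan θ ^ 2)
    have hs : Real.sin (2 * θ) = 2 * Real.tan θ * Real.cos θ ^ 2 := by
      rw [Real.sin_two_mul, Real.tan_eq_sin_div_cos]
      field_simp
    have hC2 : 1 + Real.cosh (2 * Real.tan θ ^ 2) = 2 * Real.cosh (Real.tan θ ^ 2) ^ 2 := by
      rw [Real.cosh_two_mul, Real.sinh_sq]
      ring
    rw [hs, hC2, abs_of_pos (by positivity), smul_eq_mul]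
    field_simp
    norm_num
  rw [setIntegral_congr_fun measurableSet_Ioo hpt, integral_const_mul, ← hsub]
  ring
end

section
/- Let g : [0,1] → ℝ be continuous. Then lim_{n→∞} (n/2ⁿ) · ∫₀¹ g(x)/( xⁿ + (1−x)ⁿ ) dx = (π/4)·g(1/2). -/
open Filter Topology MeasureTheory Set

theorem two_add_le_one_add_pow_add_one_sub_pow (u : ℝ) (n : ℕ) :
    2 + n * (n - 1) * u ^ 2 ≤ (1 + u) ^ n + (1 - u) ^ n := by
  suffices h : 2 + n * (n - 1) * u ^ 2 ≤ (1 + u) ^ n + (1 - u) ^ n ∧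
      2 * n * u ^ 2 ≤ u * ((1 + u) ^ n - (1 - u) ^ n) from h.1
  induction n with
  | zero => norm_num
  | succ n ih =>
    obtain ⟨hsum, hdiff⟩ := ih
    have hn : (0 : ℝ) ≤ n * (n - 1) := by
      rcases n with _ | n
      · simp
      · push_cast; simp; positivity
    have htwo : 2 ≤ (1 + u) ^ n + (1 - u) ^ n := by
      linarith [mul_nonneg hn (sq_nonneg u)]
    have hsq := mul_le_mul_of_nonneg_left htwo (sq_nonneg u)
    push_cast
    constructor
    · linear_combination hsum + hdiff
    · linear_combination hdiff + hsq

theorem half_one_add_sq_le_pow_add_pow (t : ℝ) {n : ℕ} (hn : 2 ≤ n) :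
    (1 + t ^ 2) / 2 ≤ (1 + t / n) ^ n + (1 - t / n) ^ n := by
  have hn' : (2 : ℝ) ≤ n := by exact_mod_cast hn
  have hpos : (0 : ℝ) < n := by linarith
  refine le_trans ?_ (two_add_le_one_add_pow_add_one_sub_pow (t / n) n)
  have hscale : (n : ℝ) * (n - 1) * (t / n) ^ 2 = (1 - 1 / n) * t ^ 2 := by
    field_simp
  have hinv : (1 : ℝ) / n ≤ 1 / 2 := one_div_le_one_div_of_le two_pos hn'
  rw [hscale]
  nlinarith [mul_nonneg (sub_nonneg.2 hinv) (sq_nonneg t)]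

theorem tendsto_pow_add_pow_exp (t : ℝ) :
    Tendsto (fun n : ℕ => (1 + t / n) ^ n + (1 - t / n) ^ n) atTop
      (𝓝 (Real.exp t + Real.exp (-t))) := by
  refine (Real.tendsto_one_add_div_pow_exp t).add ?_
  simpa [neg_div, sub_eq_add_neg] using Real.tendsto_one_add_div_pow_exp (-t)

theorem half_one_add_sq_le_exp_add_exp_neg (t : ℝ) :
    (1 + t ^ 2) / 2 ≤ Real.exp t + Real.exp (-t) :=
  ge_of_tendsto (tendsto_pow_add_pow_exp t)
    ((eventually_ge_atTop 2).mono fun _ hn => half_one_add_sq_le_pow_add_pow t hn)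

theorem inv_le_two_mul_inv_one_add_sq {a t : ℝ} (h : (1 + t ^ 2) / 2 ≤ a) :
    a⁻¹ ≤ 2 * (1 + t ^ 2)⁻¹ := by
  have := inv_anti₀ (by positivity) h
  rwa [inv_div, div_eq_mul_inv] at this

theorem integrable_inv_exp_add_exp_neg :
    Integrable fun t : ℝ => (Real.exp t + Real.exp (-t))⁻¹ := by
  refine (integrable_inv_one_add_sq.const_mul 2).mono' ?_ (ae_of_all _ fun t => ?_)
  · exact Continuous.aestronglyMeasurable
      (Continuous.inv₀ (by fun_prop) fun t => by positivity)
  · rw [Real.norm_of_nonneg (by positivity)]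
    exact inv_le_two_mul_inv_one_add_sq (half_one_add_sq_le_exp_add_exp_neg t)

theorem integral_inv_exp_add_exp_neg :
    ∫ t : ℝ, (Real.exp t + Real.exp (-t))⁻¹ = Real.pi / 2 := by
  have hderiv (t : ℝ) : HasDerivAt (fun t => Real.arctan (Real.exp t))
      (Real.exp t + Real.exp (-t))⁻¹ t := by
    convert (Real.hasDerivAt_exp t).arctan using 1
    rw [Real.exp_neg]
    have := Real.exp_pos t
    field_simp
    ring
  have hbot : Tendsto (fun t => Real.arctan (Real.exp t)) atBot (𝓝 0) := by
    simpa [Function.comp_def] using (Real.continuous_arctan.tendsto 0).comp Real.tendsto_exp_atBot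
  have htop : Tendsto (fun t => Real.arctan (Real.exp t)) atTop (𝓝 (Real.pi / 2)) :=
    (Real.tendsto_arctan_atTop.mono_right nhdsWithin_le_nhds).comp Real.tendsto_exp_atTop
  simpa using integral_of_hasDerivAt_of_tendsto hderiv integrable_inv_exp_add_exp_neg hbot htop

theorem rescale_integral_div_pow_add_pow (G : ℝ → ℝ) {n : ℕ} (hn : n ≠ 0) :
    ((n : ℝ) / 2 ^ n) * ∫ x in (0 : ℝ)..1, G x / (x ^ n + (1 - x) ^ n) =
      1 / 2 * ∫ t in -(n : ℝ)..n,
        G ((1 + t / n) / 2) * ((1 + t / n) ^ n + (1 - t / n) ^ n)⁻¹ := by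
  have hn' : (n : ℝ) ≠ 0 := Nat.cast_ne_zero.2 hn
  have hsub := intervalIntegral.integral_comp_mul_add (a := -(n : ℝ)) (b := n)
    (fun x => G x / (x ^ n + (1 - x) ^ n)) (c := 1 / (2 * (n : ℝ))) (by positivity) (1 / 2)
  have hleft : 1 / (2 * (n : ℝ)) * -n + 1 / 2 = 0 := by field_simp; ring
  have hright : 1 / (2 * (n : ℝ)) * n + 1 / 2 = 1 := by field_simp; ring
  have hintegrand (t : ℝ) :
      G (1 / (2 * (n : ℝ)) * t + 1 / 2) / ((1 / (2 * (n : ℝ)) * t + 1 / 2) ^ n +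
        (1 - (1 / (2 * (n : ℝ)) * t + 1 / 2)) ^ n) =
      2 ^ n * (G ((1 + t / n) / 2) * ((1 + t / n) ^ n + (1 - t / n) ^ n)⁻¹) := by
    have harg : 1 / (2 * (n : ℝ)) * t + 1 / 2 = (1 + t / n) / 2 := by field_simp; ring
    have harg' : 1 - (1 + t / n) / 2 = (1 - t / n) / 2 := by ring
    rw [harg, harg', div_pow, div_pow, ← add_div, div_div_eq_mul_div, div_eq_mul_inv]
    ring
  rw [hleft, hright] at hsub
  simp only [hintegrand, intervalIntegral.integral_const_mul, smul_eq_mul] at hsub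
  rw [one_div, inv_inv] at hsub
  rw [div_mul_eq_mul_div, div_eq_iff (by positivity)]
  linear_combination -hsub / 2

theorem tendsto_integral_div_pow_add_pow {G : ℝ → ℝ} (hG : Continuous G) {M : ℝ}
    (hM : ∀ x, ‖G x‖ ≤ M) :
    Tendsto (fun n : ℕ => ((n : ℝ) / 2 ^ n) * ∫ x in (0 : ℝ)..1, G x / (x ^ n + (1 - x) ^ n))
      atTop (𝓝 (Real.pi / 4 * G (1 / 2))) := by
  let F (n : ℕ) : ℝ → ℝ := (Ioc (-(n : ℝ)) n).indicator fun t =>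
    G ((1 + t / n) / 2) * ((1 + t / n) ^ n + (1 - t / n) ^ n)⁻¹
  have hlim : Tendsto (fun n => ∫ t, F n t) atTop
      (𝓝 (∫ t, G (1 / 2) * (Real.exp t + Real.exp (-t))⁻¹)) := by
    refine tendsto_integral_filter_of_dominated_convergence
      (fun t => M * (2 * (1 + t ^ 2)⁻¹)) ?_ ?_
      ((integrable_inv_one_add_sq.const_mul 2).const_mul M) (ae_of_all _ fun t => ?_)
    · filter_upwards [eventually_ge_atTop 2] with n hn
      refine (Continuous.aestronglyMeasurable ?_).indicator measurableSet_Ioc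
      refine (hG.comp (by fun_prop)).mul (Continuous.inv₀ (by fun_prop) fun t => ?_)
      exact ((by positivity : 0 < (1 + t ^ 2) / 2).trans_le
        (half_one_add_sq_le_pow_add_pow t hn)).ne'
    · filter_upwards [eventually_ge_atTop 2] with n hn
      refine ae_of_all _ fun t => (norm_indicator_le_norm_self _ _).trans ?_
      have hle := half_one_add_sq_le_pow_add_pow t hn
      have hpos := (by positivity : 0 < (1 + t ^ 2) / 2).trans_le hle
      rw [norm_mul, Real.norm_of_nonneg (inv_nonneg.2 hpos.le)]
      exact mul_le_mul (hM _) (inv_le_two_mul_inv_one_add_sq hle) (inv_nonneg.2 hpos.le)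
        ((norm_nonneg _).trans (hM 0))
    · have harg : Tendsto (fun n : ℕ => (1 + t / n) / 2) atTop (𝓝 (1 / 2)) := by
        simpa using ((tendsto_const_div_atTop_nhds_zero_nat t).const_add 1).div_const 2
      have hmul := ((hG.tendsto _).comp harg).mul
        ((tendsto_pow_add_pow_exp t).inv₀
          (by positivity : Real.exp t + Real.exp (-t) ≠ 0))
      refine hmul.congr' ?_
      filter_upwards [(tendsto_natCast_atTop_atTop (R := ℝ)).eventually_gt_atTop |t|] with n hn
      have hmem : t ∈ Ioc (-(n : ℝ)) n := ⟨(abs_lt.1 hn).1, (abs_lt.1 hn).2.le⟩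
      exact (indicator_of_mem hmem fun t =>
        G ((1 + t / n) / 2) * ((1 + t / n) ^ n + (1 - t / n) ^ n)⁻¹).symm
  rw [integral_const_mul, integral_inv_exp_add_exp_neg] at hlim
  have hconst : Real.pi / 4 * G (1 / 2) = 1 / 2 * (G (1 / 2) * (Real.pi / 2)) := by ring
  rw [hconst]
  refine (hlim.const_mul (1 / 2)).congr' ?_
  filter_upwards [eventually_ne_atTop 0] with n hn
  rw [rescale_integral_div_pow_add_pow G hn, integral_indicator measurableSet_Ioc,
    intervalIntegral.integral_of_le (by linarith [n.cast_nonneg (α := ℝ)])]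

theorem stmt_9 (g : ℝ → ℝ) (hg : ContinuousOn g (Set.Icc 0 1)) :
    Filter.Tendsto
      (fun n : ℕ => ((n : ℝ) / 2 ^ n) * ∫ x in (0:ℝ)..1, g x / (x ^ n + (1 - x) ^ n))
      Filter.atTop (nhds ((Real.pi / 4) * g (1 / 2))) := by
  obtain ⟨M, hM⟩ := isCompact_Icc.exists_bound_of_continuousOn hg
  let G : ℝ → ℝ := IccExtend (zero_le_one (α := ℝ)) ((Icc (0 : ℝ) 1).domRestrict g)
  have hGg {x : ℝ} (hx : x ∈ Icc (0 : ℝ) 1) : G x = g x := IccExtend_of_mem _ _ hx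
  have hG : Continuous G := hg.domRestrict.Icc_extend'
  have hGM (x : ℝ) : ‖G x‖ ≤ M := hM _ (projIcc 0 1 zero_le_one x).2
  have hlim := tendsto_integral_div_pow_add_pow hG hGM
  rw [hGg (by norm_num)] at hlim
  refine hlim.congr fun n => ?_
  congr 1
  refine intervalIntegral.integral_congr fun x hx => ?_
  rw [uIcc_of_le zero_le_one] at hx
  simp only [hGg hx]
end

section
/- ∫₀^∞ (cos x − 1) / ( x·(e^x − 1) ) dx = (1/2)·log( π / sinh π ). -/
open MeasureTheory Filter Topology Set

/-- The Laplace transform of `x ↦ sin (t x)`. -/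
theorem integral_exp_neg_mul_sin {a : ℝ} (ha : 0 < a) (t : ℝ) :
    ∫ x in Ioi (0:ℝ), Real.exp (-a * x) * Real.sin (x * t) = t / (a ^ 2 + t ^ 2) := by
  have hne : a ^ 2 + t ^ 2 ≠ 0 := by positivity
  have hexp : IntegrableOn (fun x : ℝ => Real.exp (-a * x)) (Ioi 0) :=
    integrableOn_exp_mul_Ioi (by linarith) 0
  have hint : IntegrableOn (fun x : ℝ => Real.exp (-a * x) * Real.sin (x * t)) (Ioi 0) := by
    refine Integrable.mono' hexp (by fun_prop) (Eventually.of_forall fun x => ?_)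
    rw [norm_mul, Real.norm_of_nonneg (Real.exp_pos _).le]
    exact mul_le_of_le_one_right (Real.exp_pos _).le (Real.abs_sin_le_one _)
  have hlim : Tendsto (fun x : ℝ => Real.exp (-a * x)) atTop (𝓝 0) :=
    Real.tendsto_exp_atBot.comp (tendsto_id.const_mul_atTop_of_neg (by linarith))
  have hderiv : ∀ x ∈ Ici (0:ℝ), HasDerivAt
      (fun x => -(Real.exp (-a * x) * ((a * Real.sin (x * t) + t * Real.cos (x * t))
        / (a ^ 2 + t ^ 2)))) (Real.exp (-a * x) * Real.sin (x * t)) x := by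
    intro x _
    have h1 : HasDerivAt (fun x : ℝ => Real.exp (-a * x)) (Real.exp (-a * x) * (-a * 1)) x :=
      ((hasDerivAt_id x).const_mul (-a)).exp
    have h2 : HasDerivAt (fun x : ℝ => x * t) (1 * t) x := (hasDerivAt_id x).mul_const t
    convert! (h1.mul (((h2.sin.const_mul a).add (h2.cos.const_mul t)).div_const
      (a ^ 2 + t ^ 2))).neg using 1
    simp only [Pi.add_apply]
    field_simp
    ring
  have htend : Tendsto
      (fun x => -(Real.exp (-a * x) * ((a * Real.sin (x * t) + t * Real.cos (x * t))
        / (a ^ 2 + t ^ 2)))) atTop (𝓝 0) := by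
    rw [← neg_zero]
    refine (hlim.zero_mul_isBoundedUnder_le ?_).neg
    refine isBoundedUnder_of ⟨(|a| + |t|) / (a ^ 2 + t ^ 2), fun x => ?_⟩
    simp only [Function.comp, Real.norm_eq_abs]
    rw [abs_div, abs_of_pos (by positivity : 0 < a ^ 2 + t ^ 2)]
    gcongr
    refine (abs_add_le _ _).trans ?_
    rw [abs_mul, abs_mul]
    exact add_le_add (mul_le_of_le_one_right (abs_nonneg _) (Real.abs_sin_le_one _))
      (mul_le_of_le_one_right (abs_nonneg _) (Real.abs_cos_le_one _))
  rw [integral_Ioi_of_hasDerivAt_of_tendsto' hderiv hint htend]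
  simp

theorem intervalIntegral_sin_mul {x : ℝ} (hx : x ≠ 0) :
    ∫ t in (0:ℝ)..1, Real.sin (x * t) = (1 - Real.cos x) / x := by
  rw [intervalIntegral.integral_comp_mul_left _ hx, integral_sin]
  simp [div_eq_inv_mul]

theorem intervalIntegral_div_sq_add_sq {a : ℝ} (ha : 0 < a) :
    ∫ t in (0:ℝ)..1, t / (a ^ 2 + t ^ 2) = 1 / 2 * Real.log (1 + 1 / a ^ 2) := by
  have hderiv : ∀ t ∈ uIcc (0:ℝ) 1,
      HasDerivAt (fun t => 1 / 2 * Real.log (a ^ 2 + t ^ 2)) (t / (a ^ 2 + t ^ 2)) t := by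
    intro t _
    have hne : a ^ 2 + t ^ 2 ≠ 0 := by positivity
    convert! ((((hasDerivAt_id t).pow 2).const_add (a ^ 2)).log hne).const_mul (1 / 2) using 1
    simp
    field_simp
  have hcont : Continuous fun t : ℝ => t / (a ^ 2 + t ^ 2) :=
    continuous_id.div (by fun_prop) fun t => by positivity
  rw [intervalIntegral.integral_eq_sub_of_hasDerivAt hderiv (hcont.intervalIntegrable _ _),
    ← mul_sub, ← Real.log_div (by positivity) (by positivity)]
  congr 2
  field_simp
  ring

theorem integrable_exp_neg_mul_sin_prod {a : ℝ} (ha : 0 < a) :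
    Integrable (Function.uncurry fun x t : ℝ => Real.exp (-a * x) * Real.sin (x * t))
      ((volume.restrict (Ioi 0)).prod (volume.restrict (Ioc 0 1))) := by
  have hexp : IntegrableOn (fun x : ℝ => Real.exp (-a * x)) (Ioi 0) :=
    integrableOn_exp_mul_Ioi (by linarith) 0
  refine Integrable.mono' (hexp.comp_fst (volume.restrict (Ioc (0:ℝ) 1)))
    (by unfold Function.uncurry; fun_prop) (Eventually.of_forall fun p => ?_)
  simp only [Function.uncurry]
  rw [norm_mul, Real.norm_of_nonneg (Real.exp_pos _).le]
  exact mul_le_of_le_one_right (Real.exp_pos _).le (Real.abs_sin_le_one _)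

theorem integral_sin_eq_exp_neg_mul_one_sub_cos_div (a : ℝ) {x : ℝ} (hx : x ≠ 0) :
    ∫ t in Ioc (0:ℝ) 1, Real.exp (-a * x) * Real.sin (x * t)
      = Real.exp (-a * x) * ((1 - Real.cos x) / x) := by
  rw [integral_const_mul, ← intervalIntegral.integral_of_le zero_le_one,
    intervalIntegral_sin_mul hx]

theorem integrableOn_exp_neg_mul_one_sub_cos_div {a : ℝ} (ha : 0 < a) :
    IntegrableOn (fun x : ℝ => Real.exp (-a * x) * ((1 - Real.cos x) / x)) (Ioi 0) :=
  IntegrableOn.congr_fun (integrable_exp_neg_mul_sin_prod ha).integral_prod_left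
    (fun _ hx => integral_sin_eq_exp_neg_mul_one_sub_cos_div a (ne_of_gt hx)) measurableSet_Ioi

theorem integral_exp_neg_mul_one_sub_cos_div {a : ℝ} (ha : 0 < a) :
    ∫ x in Ioi (0:ℝ), Real.exp (-a * x) * ((1 - Real.cos x) / x)
      = 1 / 2 * Real.log (1 + 1 / a ^ 2) := by
  rw [← intervalIntegral_div_sq_add_sq ha, intervalIntegral.integral_of_le zero_le_one,
    ← setIntegral_congr_fun measurableSet_Ioi
      fun _ hx => integral_sin_eq_exp_neg_mul_one_sub_cos_div a (ne_of_gt hx),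
    integral_integral_swap (integrable_exp_neg_mul_sin_prod ha)]
  simp only [integral_exp_neg_mul_sin ha]

theorem hasSum_log_one_add_inv_sq :
    HasSum (fun n : ℕ => Real.log (1 + 1 / ((n:ℝ) + 1) ^ 2))
      (Real.log (Real.sinh Real.pi / Real.pi)) := by
  have hprod : Tendsto (fun n : ℕ => ∏ i ∈ Finset.range n, (1 + 1 / ((i:ℝ) + 1) ^ 2)) atTop
      (𝓝 (Real.sinh Real.pi / Real.pi)) := by
    have h := tendsto_euler_sin_prod' Complex.I_ne_zero
    have hlim : Complex.sin (Real.pi * Complex.I) / (Real.pi * Complex.I)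
        = ((Real.sinh Real.pi / Real.pi : ℝ) : ℂ) := by
      rw [Complex.sin_mul_I, mul_div_mul_right _ _ Complex.I_ne_zero]
      push_cast
      rfl
    rw [hlim] at h
    rw [← tendsto_ofReal_iff]
    refine h.congr fun n => ?_
    push_cast [sineTerm]
    simp
  rw [hasSum_iff_tendsto_nat_of_nonneg fun n => Real.log_nonneg (by simp; positivity)]
  have hpos : Real.sinh Real.pi / Real.pi ≠ 0 :=
    (div_pos (Real.sinh_pos_iff.2 Real.pi_pos) Real.pi_pos).ne'
  refine (hprod.log hpos).congr fun n => ?_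
  exact Real.log_prod fun i _ => by positivity

theorem hasSum_exp_neg_succ_mul {x : ℝ} (hx : 0 < x) :
    HasSum (fun n : ℕ => Real.exp (-((n:ℝ) + 1) * x)) (1 / (Real.exp x - 1)) := by
  have hgeom := (hasSum_geometric_of_lt_one (Real.exp_pos (-x)).le
    (Real.exp_lt_one_iff.2 (neg_lt_zero.2 hx))).mul_left (Real.exp (-x))
  have h1 : Real.exp x - 1 ≠ 0 := (sub_pos.2 (Real.one_lt_exp_iff.2 hx)).ne'
  convert! hgeom using 1
  · funext n
    rw [← Real.exp_nat_mul, ← Real.exp_add]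
    congr 1
    ring
  · rw [Real.exp_neg]
    have := Real.exp_ne_zero x
    field_simp

theorem stmt_10 :
    ∫ x in Set.Ioi (0:ℝ), (Real.cos x - 1) / (x * (Real.exp x - 1))
      = (1 / 2) * Real.log (Real.pi / Real.sinh Real.pi) := by
  have hpos (n : ℕ) : (0:ℝ) < (n:ℝ) + 1 := by positivity
  have hnorm (n : ℕ) :
      ∫ x in Ioi (0:ℝ), ‖Real.exp (-((n:ℝ) + 1) * x) * ((1 - Real.cos x) / x)‖
        = 1 / 2 * Real.log (1 + 1 / ((n:ℝ) + 1) ^ 2) := by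
    rw [← integral_exp_neg_mul_one_sub_cos_div (hpos n)]
    refine setIntegral_congr_fun measurableSet_Ioi fun x hx => Real.norm_of_nonneg ?_
    exact mul_nonneg (Real.exp_pos _).le
      (div_nonneg (sub_nonneg.2 (Real.cos_le_one x)) (le_of_lt hx))
  have hlog := hasSum_log_one_add_inv_sq.mul_left (1 / 2)
  have hsum := hasSum_integral_of_summable_integral_norm
    (fun n : ℕ => integrableOn_exp_neg_mul_one_sub_cos_div (hpos n))
    (by simpa only [hnorm] using hlog.summable)
  simp only [integral_exp_neg_mul_one_sub_cos_div (hpos _)] at hsum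
  have hval := hsum.unique hlog
  have hflip : Real.log (Real.pi / Real.sinh Real.pi)
      = -Real.log (Real.sinh Real.pi / Real.pi) := by
    rw [← Real.log_inv, inv_div]
  rw [hflip, mul_neg, ← hval, ← integral_neg]
  refine setIntegral_congr_fun measurableSet_Ioi fun x hx => ?_
  simp only [((hasSum_exp_neg_succ_mul hx).mul_right ((1 - Real.cos x) / x)).tsum_eq]
  rw [div_mul_div_comm, one_mul, ← neg_div, neg_sub, mul_comm x]
end

section
/- Let f : [0,∞) → ℝ be continuous and suppose that for every x > 0, f(x)·( f(x) − (1/x)·∫₀^x f(t) dt ) ≥ ( f(x) − 1 )². Then f(x) = 1 for every x ≥ 0. -/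
open Filter Topology Set

/-- The running average of a continuous function has the expected derivative. -/
lemma hasDerivAt_integral_div {g : ℝ → ℝ} (hg : Continuous g) {x : ℝ} (hx : 0 < x) :
    HasDerivAt (fun y => (∫ t in (0:ℝ)..y, g t) / y) ((g x - (∫ t in (0:ℝ)..x, g t) / x) / x) x := by
  have h := (hg.integral_hasStrictDerivAt 0 x).hasDerivAt.fun_div (hasDerivAt_id' x) hx.ne'
  refine h.congr_deriv ?_
  field_simp

/-- The running average of a continuous function tends to its value at the origin. -/
lemma tendsto_integral_div {g : ℝ → ℝ} (hg : Continuous g) :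
    Tendsto (fun y => (∫ t in (0:ℝ)..y, g t) / y) (𝓝[>] 0) (𝓝 (g 0)) := by
  have h := (hg.integral_hasStrictDerivAt 0 0).hasDerivAt.tendsto_slope_zero_right
  refine h.congr fun y => ?_
  simp [div_eq_inv_mul]

/-- A function with `B ^ 2 ≤ x * B'` that is positive at some point cannot stay bounded by
positive values on a whole half-line. -/
lemma not_forall_pos_of_sq_div_le_deriv {B B' : ℝ → ℝ} {a : ℝ} (ha : 0 < a)
    (hpos : ∀ x ≥ a, 0 < B x) (hB : ∀ x ≥ a, HasDerivAt B (B' x) x)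
    (hle : ∀ x ≥ a, B x ^ 2 / x ≤ B' x) : False := by
  have hd : ∀ x ≥ a, HasDerivAt (fun y => (B y)⁻¹ + Real.log y) (-B' x / B x ^ 2 + x⁻¹) x :=
    fun x hx => ((hB x hx).fun_inv (hpos x hx).ne').add (Real.hasDerivAt_log (ha.trans_le hx).ne')
  have hanti : AntitoneOn (fun y => (B y)⁻¹ + Real.log y) (Ici a) := by
    refine antitoneOn_of_deriv_nonpos (convex_Ici a)
      (fun x hx => (hd x hx).continuousAt.continuousWithinAt)
      (fun x hx => (hd x (interior_subset hx)).differentiableAt.differentiableWithinAt)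
      fun x hx => ?_
    have hx' : a ≤ x := interior_subset hx
    rw [(hd x hx').deriv]
    have h2 : 0 < B x ^ 2 := pow_pos (hpos x hx') 2
    have h3 : x⁻¹ ≤ B' x / B x ^ 2 := by
      rw [le_div_iff₀ h2, ← div_eq_inv_mul]
      exact hle x hx'
    rw [neg_div]
    linarith
  obtain ⟨x, hx, hlog⟩ := ((eventually_ge_atTop a).and
    (Real.tendsto_log_atTop.eventually_gt_atTop ((B a)⁻¹ + Real.log a))).exists
  have h1 : (B x)⁻¹ + Real.log x ≤ (B a)⁻¹ + Real.log a := hanti self_mem_Ici hx hx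
  have h2 := inv_pos.2 (hpos x hx)
  linarith

/-- The rigidity statement for a continuous function on the whole line. -/
lemma eq_one_of_one_le_mul_two_sub_average {g : ℝ → ℝ} (hg : Continuous g)
    (h : ∀ x > (0:ℝ), 1 ≤ g x * (2 - (∫ t in (0:ℝ)..x, g t) / x)) :
    ∀ x ≥ (0:ℝ), g x = 1 := by
  have hderiv := fun x (hx : 0 < x) => hasDerivAt_integral_div hg hx
  have hlim := tendsto_integral_div hg
  set A : ℝ → ℝ := fun y => (∫ t in (0:ℝ)..y, g t) / y with hA
  replace h : ∀ x > (0:ℝ), 1 ≤ g x * (2 - A x) := h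
  replace hderiv : ∀ x > (0:ℝ), HasDerivAt A ((g x - A x) / x) x := hderiv
  have hg0 : g 0 = 1 := by
    have hl : Tendsto (fun x => g x * (2 - A x)) (𝓝[>] 0) (𝓝 (g 0 * (2 - g 0))) :=
      (hg.continuousAt.tendsto.mono_left nhdsWithin_le_nhds).mul (hlim.const_sub 2)
    have := ge_of_tendsto hl (eventually_mem_nhdsWithin.mono h)
    nlinarith [sq_nonneg (g 0 - 1)]
  have hgpos : ∀ x > 0, 0 < g x := by
    intro x hx
    by_contra! hneg
    obtain ⟨c, hc, hc0⟩ := intermediate_value_Icc' hx.le hg.continuousOn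
      (show (0:ℝ) ∈ Icc (g x) (g 0) from ⟨hneg, by simp [hg0]⟩)
    rcases hc.1.eq_or_lt with rfl | hc'
    · simp [hg0] at hc0
    · have := h c hc'
      norm_num [hc0] at this
  have hA2 : ∀ x > 0, 0 < 2 - A x := fun x hx =>
    pos_of_mul_pos_right (one_pos.trans_le (h x hx)) (hgpos x hx).le
  have hAg : ∀ x > 0, A x ≤ g x := by
    intro x hx
    refine le_of_mul_le_mul_right ?_ (hA2 x hx)
    nlinarith [h x hx, sq_nonneg (A x - 1)]
  have hmono : MonotoneOn A (Ioi 0) := by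
    refine monotoneOn_of_deriv_nonneg (convex_Ioi 0)
      (fun x hx => (hderiv x hx).continuousAt.continuousWithinAt)
      (fun x hx => (hderiv x (interior_subset hx)).differentiableAt.differentiableWithinAt)
      fun x hx => ?_
    have hx' : 0 < x := interior_subset hx
    rw [(hderiv x hx').deriv]
    exact div_nonneg (sub_nonneg.2 (hAg x hx')) hx'.le
  have hA1 : ∀ x > 0, 1 ≤ A x := by
    intro x hx
    rw [← hg0]
    refine le_of_tendsto hlim ?_
    filter_upwards [Ioo_mem_nhdsGT hx] with y hy
    exact hmono hy.1 hx hy.2.le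
  have hAeq : ∀ x > 0, A x = 1 := by
    intro a ha
    by_contra hne
    have hlt : 1 < A a := lt_of_le_of_ne (hA1 a ha) (Ne.symm hne)
    refine not_forall_pos_of_sq_div_le_deriv (B := fun x => A x - 1)
      (B' := fun x => (g x - A x) / x) ha
      (fun x hx => sub_pos.2 (hlt.trans_le (hmono ha (ha.trans_le hx) hx)))
      (fun x hx => (hderiv x (ha.trans_le hx)).sub_const 1) fun x hx => ?_
    have hx0 := ha.trans_le hx
    refine div_le_div_of_nonneg_right ?_ hx0.le
    rw [le_sub_iff_add_le]
    refine le_of_mul_le_mul_right ?_ (hA2 x hx0)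
    have h3 : 0 ≤ (A x - 1) ^ 3 := pow_nonneg (sub_nonneg.2 (hA1 x hx0)) 3
    nlinarith [h x hx0]
  intro x hx
  rcases hx.eq_or_lt with rfl | hx
  · exact hg0
  · have hconst : A =ᶠ[𝓝 x] fun _ => 1 := (Ioi_mem_nhds hx |> eventually_of_mem) hAeq
    have := (hderiv x hx).unique ((hasDerivAt_const x (1:ℝ)).congr_of_eventuallyEq hconst)
    rw [hAeq x hx, div_eq_zero_iff, or_iff_left hx.ne'] at this
    linarith

theorem stmt_11 (f : ℝ → ℝ) (hf : ContinuousOn f (Set.Ici 0))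
    (h : ∀ x > (0:ℝ), (f x - 1) ^ 2 ≤ f x * (f x - (1 / x) * ∫ t in (0:ℝ)..x, f t)) :
    ∀ x ≥ (0:ℝ), f x = 1 := by
  have hg : Continuous fun x => f (max x 0) :=
    hf.comp_continuous (by fun_prop) fun x => le_max_right x 0
  intro x hx
  have key := eq_one_of_one_le_mul_two_sub_average hg (fun y hy => ?_) x hx
  · simpa [max_eq_left hx] using key
  · have hint : ∫ t in (0:ℝ)..y, f (max t 0) = ∫ t in (0:ℝ)..y, f t := by
      refine intervalIntegral.integral_congr fun t ht => ?_
      rw [uIcc_of_le hy.le] at ht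
      simp [max_eq_left ht.1]
    rw [hint, max_eq_left hy.le, div_eq_inv_mul, ← one_div]
    linarith [h y hy]
end

section
/- ∫₀^∞ ( 1 − x²·sin²(1/x) )² dx = π/5. -/
open Real Set Filter Topology MeasureTheory

lemma hasDerivAt_arctan_primitive (t : ℝ) :
    HasDerivAt (fun t : ℝ => (176 * arctan (t / 2) - 160 * (t / (t ^ 2 + 4))
      + 128 * (t / (t ^ 2 + 4) ^ 2) - 128 * arctan (t / 4)) / 120)
      ((512 / (t ^ 2 + 4) - 1664 / (t ^ 2 + 4) ^ 2 + 2048 / (t ^ 2 + 4) ^ 3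
        - 512 / (t ^ 2 + 16)) / 120) t := by
  have h4 : t ^ 2 + 4 ≠ 0 := by positivity
  have h16 : t ^ 2 + 16 ≠ 0 := by positivity
  have hv : HasDerivAt (fun t : ℝ => t ^ 2 + 4) (2 * t) t := by
    simpa using (hasDerivAt_pow 2 t).add_const (4 : ℝ)
  have hid := hasDerivAt_id' t
  have := (((((hid.div_const 2).arctan.const_mul 176).sub ((hid.div hv h4).const_mul 160)).add
    ((hid.div (hv.pow 2) (pow_ne_zero 2 h4)).const_mul 128)).sub
    ((hid.div_const 4).arctan.const_mul 128)).div_const 120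
  refine this.congr_deriv ?_
  have e2 : 1 + (t / 2) ^ 2 = (t ^ 2 + 4) / 4 := by ring
  have e4 : 1 + (t / 4) ^ 2 = (t ^ 2 + 16) / 16 := by ring
  rw [e2, e4]
  simp only [Nat.cast_ofNat, Pi.pow_apply]
  field_simp
  ring

lemma tendsto_div_sq_add_atTop : Tendsto (fun t : ℝ => t / (t ^ 2 + 4)) atTop (𝓝 0) := by
  refine squeeze_zero' (g := fun t : ℝ => t⁻¹) ?_ ?_ tendsto_inv_atTop_zero
  · filter_upwards [eventually_gt_atTop 0] with t ht
    positivity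
  · filter_upwards [eventually_gt_atTop 0] with t ht
    rw [div_le_iff₀ (by positivity)]
    field_simp
    linarith

lemma tendsto_div_sq_add_sq_atTop : Tendsto (fun t : ℝ => t / (t ^ 2 + 4) ^ 2) atTop (𝓝 0) := by
  refine squeeze_zero' ?_ ?_ tendsto_div_sq_add_atTop
  · filter_upwards [eventually_gt_atTop 0] with t ht
    positivity
  · filter_upwards [eventually_gt_atTop 0] with t ht
    gcongr
    nlinarith [sq_nonneg t]

lemma tendsto_arctan_primitive :
    Tendsto (fun t : ℝ => (176 * arctan (t / 2) - 160 * (t / (t ^ 2 + 4))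
      + 128 * (t / (t ^ 2 + 4) ^ 2) - 128 * arctan (t / 4)) / 120) atTop (𝓝 (π / 5)) := by
  have ha : ∀ c : ℝ, 0 < c → Tendsto (fun t : ℝ => arctan (t / c)) atTop (𝓝 (π / 2)) :=
    fun c hc => (tendsto_arctan_atTop.mono_right nhdsWithin_le_nhds).comp
      (tendsto_id.atTop_div_const hc)
  have := (((((ha 2 two_pos).const_mul 176).sub (tendsto_div_sq_add_atTop.const_mul 160)).add
    (tendsto_div_sq_add_sq_atTop.const_mul 128)).sub ((ha 4 four_pos).const_mul 128)).div_const 120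
  convert this using 2
  ring

lemma integrableOn_pow_mul_exp (n : ℕ) {t : ℝ} (ht : 0 < t) :
    IntegrableOn (fun u : ℝ => u ^ n * exp (-(t * u))) (Ioi 0) := by
  have := integrableOn_rpow_mul_exp_neg_mul_rpow (p := 1) (s := n) (b := t)
    (by have := n.cast_nonneg (α := ℝ); linarith) one_pos ht
  simpa using this

lemma integrableOn_pow_mul_cexp (n : ℕ) {z : ℂ} (hz : 0 < z.re) :
    IntegrableOn (fun u : ℝ => (u : ℂ) ^ n * Complex.exp (-(z * u))) (Ioi 0) := by
  refine (integrableOn_pow_mul_exp n hz).mono' (by fun_prop) ?_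
  refine (ae_restrict_iff' measurableSet_Ioi).2 (.of_forall fun u hu => ?_)
  simp [Complex.norm_exp, abs_of_pos (mem_Ioi.1 hu)]

lemma tendsto_pow_mul_cexp_atTop (n : ℕ) {z : ℂ} (hz : 0 < z.re) :
    Tendsto (fun u : ℝ => (u : ℂ) ^ n * Complex.exp (-(z * u))) atTop (𝓝 0) := by
  rw [tendsto_zero_iff_norm_tendsto_zero]
  refine (tendsto_rpow_mul_exp_neg_mul_atTop_nhds_zero n z.re hz).congr' ?_
  filter_upwards [eventually_gt_atTop 0] with u hu
  simp [Complex.norm_exp, abs_of_pos hu]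

lemma integral_pow_mul_cexp (n : ℕ) {z : ℂ} (hz : 0 < z.re) :
    ∫ u in Ioi (0 : ℝ), (u : ℂ) ^ n * Complex.exp (-(z * u)) = n.factorial / z ^ (n + 1) := by
  have hz0 : z ≠ 0 := by rintro rfl; simp at hz
  have hexp : ∀ u : ℝ, HasDerivAt (fun u : ℝ => Complex.exp (-(z * u)))
      (-z * Complex.exp (-(z * u))) u := fun u => by
    have := (((hasDerivAt_id' (u : ℂ)).const_mul z).neg.cexp).comp_ofReal
    exact this.congr_deriv (by simp [mul_comm])
  induction n with
  | zero =>
    have := integral_Ioi_of_hasDerivAt_of_tendsto' (a := 0)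
      (fun u _ => (hexp u)) ?_ (by simpa using tendsto_pow_mul_cexp_atTop 0 hz)
    · rw [integral_const_mul] at this
      simp at this ⊢
      field_simp
      exact this
    · simpa [IntegrableOn] using (integrableOn_pow_mul_cexp 0 hz).const_mul (-z)
  | succ n ih =>
    have h1 := (integrableOn_pow_mul_cexp n hz).const_mul ((n : ℂ) + 1)
    have h2 := (integrableOn_pow_mul_cexp (n + 1) hz).const_mul z
    have := integral_Ioi_of_hasDerivAt_of_tendsto' (a := 0)
      (f' := fun u : ℝ => ((n : ℂ) + 1) * ((u : ℂ) ^ n * Complex.exp (-(z * u))) -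
        z * ((u : ℂ) ^ (n + 1) * Complex.exp (-(z * u))))
      (fun u _ => (((hasDerivAt_pow (n + 1) (u : ℂ)).comp_ofReal).mul (hexp u)).congr_deriv
        (by push_cast; simp; ring)) (h1.sub h2) (tendsto_pow_mul_cexp_atTop (n + 1) hz)
    rw [integral_sub h1 h2, integral_const_mul, integral_const_mul, ih] at this
    simp at this
    rw [Nat.factorial_succ]
    push_cast
    field_simp at this ⊢
    linear_combination -this

lemma re_pow_mul_cexp (n : ℕ) (t b u : ℝ) :
    ((u : ℂ) ^ n * Complex.exp (-((t + b * Complex.I) * u))).re =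
      u ^ n * exp (-(t * u)) * cos (b * u) := by
  rw [← Complex.ofReal_pow, Complex.re_ofReal_mul, Complex.exp_re]
  simp [mul_assoc]

lemma integrableOn_pow_mul_exp_mul_cos (n : ℕ) {t : ℝ} (ht : 0 < t) (b : ℝ) :
    IntegrableOn (fun u : ℝ => u ^ n * exp (-(t * u)) * cos (b * u)) (Ioi 0) := by
  have hz : 0 < ((t : ℂ) + b * Complex.I).re := by simpa using ht
  have := (integrableOn_pow_mul_cexp n hz).re
  simpa only [IntegrableOn, RCLike.re_eq_complex_re, re_pow_mul_cexp] using this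

lemma integral_pow_mul_exp_mul_cos (n : ℕ) {t : ℝ} (ht : 0 < t) (b : ℝ) :
    ∫ u in Ioi (0 : ℝ), u ^ n * exp (-(t * u)) * cos (b * u) =
      n.factorial * (((t : ℂ) - b * Complex.I) ^ (n + 1)).re / (t ^ 2 + b ^ 2) ^ (n + 1) := by
  have hz : 0 < ((t : ℂ) + b * Complex.I).re := by simpa using ht
  have := integral_re (integrableOn_pow_mul_cexp n hz)
  simp only [RCLike.re_eq_complex_re, re_pow_mul_cexp] at this
  rw [this, integral_pow_mul_cexp n hz]
  have hz0 : (t : ℂ) + b * Complex.I ≠ 0 := by intro h; simp [h] at hz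
  have hn : (((t ^ 2 + b ^ 2 : ℝ)) : ℂ) ≠ 0 := by
    exact_mod_cast (by positivity : t ^ 2 + b ^ 2 ≠ 0)
  have key : (n.factorial : ℂ) / ((t : ℂ) + b * Complex.I) ^ (n + 1) =
      ((n.factorial / (t ^ 2 + b ^ 2) ^ (n + 1) : ℝ) : ℂ) * ((t : ℂ) - b * Complex.I) ^ (n + 1) := by
    have hmul : (((t ^ 2 + b ^ 2 : ℝ)) : ℂ) =
        ((t : ℂ) + b * Complex.I) * ((t : ℂ) - b * Complex.I) := by
      push_cast
      linear_combination ((b : ℂ) ^ 2) * Complex.I_sq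
    rw [Complex.ofReal_div, Complex.ofReal_pow, hmul, mul_pow]
    rw [hmul] at hn
    have := right_ne_zero_of_mul hn
    push_cast
    field_simp
  rw [key, Complex.re_ofReal_mul]
  ring

lemma sq_sub_sin_sq_sq (u : ℝ) : (u ^ 2 - sin u ^ 2) ^ 2 =
    u ^ 4 * cos (0 * u) - u ^ 2 * cos (0 * u) + u ^ 2 * cos (2 * u) + 3 / 8 * cos (0 * u)
      - 1 / 2 * cos (2 * u) + 1 / 8 * cos (4 * u) := by
  have h4 : cos (4 * u) = 2 * cos (2 * u) ^ 2 - 1 := by rw [← cos_two_mul]; ring_nf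
  rw [h4, cos_two_mul, sin_sq, zero_mul, cos_zero]
  ring

lemma integrableOn_and_integral_sq_sub_sin_sq_sq {t : ℝ} (ht : 0 < t) :
    IntegrableOn (fun u : ℝ => t ^ 5 / 120 * exp (-(t * u)) * (u ^ 2 - sin u ^ 2) ^ 2) (Ioi 0) ∧
    ∫ u in Ioi (0 : ℝ), t ^ 5 / 120 * exp (-(t * u)) * (u ^ 2 - sin u ^ 2) ^ 2 =
      (512 / (t ^ 2 + 4) - 1664 / (t ^ 2 + 4) ^ 2 + 2048 / (t ^ 2 + 4) ^ 3
        - 512 / (t ^ 2 + 16)) / 120 := by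
  have hi (n : ℕ) (b : ℝ) := integrableOn_pow_mul_exp_mul_cos n ht b
  have hI (n : ℕ) (b : ℝ) := integral_pow_mul_exp_mul_cos n ht b
  have e : (fun u : ℝ => t ^ 5 / 120 * exp (-(t * u)) * (u ^ 2 - sin u ^ 2) ^ 2) = fun u =>
      t ^ 5 / 120 * (u ^ 4 * exp (-(t * u)) * cos (0 * u) - u ^ 2 * exp (-(t * u)) * cos (0 * u)
      + u ^ 2 * exp (-(t * u)) * cos (2 * u) + 3 / 8 * (u ^ 0 * exp (-(t * u)) * cos (0 * u))
      - 1 / 2 * (u ^ 0 * exp (-(t * u)) * cos (2 * u))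
      + 1 / 8 * (u ^ 0 * exp (-(t * u)) * cos (4 * u))) := by
    funext u
    rw [sq_sub_sin_sq_sq]
    ring
  have i2 := (hi 4 0).sub (hi 2 0)
  have i3 := i2.add (hi 2 2)
  have i4 := i3.add ((hi 0 0).const_mul (3 / 8))
  have i5 := i4.sub ((hi 0 2).const_mul (1 / 2))
  have i6 := i5.add ((hi 0 4).const_mul (1 / 8))
  rw [e]
  refine ⟨i6.const_mul _, ?_⟩
  have h1 := integral_sub (hi 4 0) (hi 2 0)
  have h2 := integral_add i2 (hi 2 2)
  have h3 := integral_add i3 ((hi 0 0).const_mul (3 / 8))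
  have h4 := integral_sub i4 ((hi 0 2).const_mul (1 / 2))
  have h5 := integral_add i5 ((hi 0 4).const_mul (1 / 8))
  simp only [Pi.add_apply, Pi.sub_apply, integral_const_mul] at h1 h2 h3 h4 h5
  rw [integral_const_mul, h5, h4, h3, h2, h1]
  simp only [hI]
  simp [pow_succ, Nat.factorial]
  field_simp
  ring

lemma integral_pow_five_mul_exp {u : ℝ} (hu : 0 < u) :
    ∫ t in Ioi (0 : ℝ), t ^ 5 * exp (-(t * u)) = 120 / u ^ 6 := by
  have := integral_pow_mul_exp_mul_cos 5 hu 0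
  simp only [zero_mul, cos_zero, mul_one] at this
  simp only [mul_comm _ u, this]
  simp [← Complex.ofReal_pow, Nat.factorial]
  field_simp

lemma lintegral_sq_sub_sin_sq_sq_div :
    ∫⁻ u in Ioi (0 : ℝ), ENNReal.ofReal ((u ^ 2 - sin u ^ 2) ^ 2 / u ^ 6) =
      ENNReal.ofReal (π / 5) := by
  calc
    _ = ∫⁻ u in Ioi (0 : ℝ), ∫⁻ t in Ioi (0 : ℝ),
        ENNReal.ofReal (t ^ 5 / 120 * exp (-(t * u)) * (u ^ 2 - sin u ^ 2) ^ 2) := by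
      refine setLIntegral_congr_fun measurableSet_Ioi fun u hu => ?_
      have hu' : 0 < u := hu
      have e : (fun t : ℝ => t ^ 5 / 120 * exp (-(t * u)) * (u ^ 2 - sin u ^ 2) ^ 2) =
          fun t => (u ^ 2 - sin u ^ 2) ^ 2 / 120 * (t ^ 5 * exp (-(t * u))) := by
        funext t
        ring
      have hi : IntegrableOn (fun t : ℝ => t ^ 5 * exp (-(t * u))) (Ioi 0) := by
        simpa only [mul_comm u] using integrableOn_pow_mul_exp 5 hu'
      rw [← ofReal_integral_eq_lintegral_ofReal]
      · rw [e, integral_const_mul, integral_pow_five_mul_exp hu']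
        congr 1
        field_simp
      · rw [e]
        exact hi.const_mul _
      · refine (ae_restrict_iff' measurableSet_Ioi).2 (.of_forall fun t ht => ?_)
        have : 0 < t := ht
        simp only [Pi.zero_apply]
        positivity
    _ = ∫⁻ t in Ioi (0 : ℝ), ∫⁻ u in Ioi (0 : ℝ),
        ENNReal.ofReal (t ^ 5 / 120 * exp (-(t * u)) * (u ^ 2 - sin u ^ 2) ^ 2) := by
      refine lintegral_lintegral_swap (Measurable.aemeasurable ?_)
      unfold Function.uncurry
      fun_prop
    _ = ∫⁻ t in Ioi (0 : ℝ), ENNReal.ofReal ((512 / (t ^ 2 + 4) - 1664 / (t ^ 2 + 4) ^ 2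
        + 2048 / (t ^ 2 + 4) ^ 3 - 512 / (t ^ 2 + 16)) / 120) := by
      refine setLIntegral_congr_fun measurableSet_Ioi fun t ht => ?_
      have ht' : 0 < t := ht
      obtain ⟨hi, hI⟩ := integrableOn_and_integral_sq_sub_sin_sq_sq ht'
      rw [← hI, ofReal_integral_eq_lintegral_ofReal hi]
      exact .of_forall fun u => by simp only [Pi.zero_apply]; positivity
    _ = ENNReal.ofReal (π / 5) := by
      have hnn : ∀ t ∈ Ioi (0 : ℝ), 0 ≤ (512 / (t ^ 2 + 4) - 1664 / (t ^ 2 + 4) ^ 2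
          + 2048 / (t ^ 2 + 4) ^ 3 - 512 / (t ^ 2 + 16)) / 120 := by
        intro t ht
        have ht' : 0 < t := ht
        rw [← (integrableOn_and_integral_sq_sub_sin_sq_sq ht').2]
        exact integral_nonneg fun u => by simp only [Pi.zero_apply]; positivity
      rw [← ofReal_integral_eq_lintegral_ofReal
        (integrableOn_Ioi_deriv_of_nonneg' (fun t _ => hasDerivAt_arctan_primitive t) hnn
          tendsto_arctan_primitive)
        ((ae_restrict_iff' measurableSet_Ioi).2 (.of_forall hnn)),
        integral_Ioi_of_hasDerivAt_of_nonneg' (fun t _ => hasDerivAt_arctan_primitive t) hnn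
          tendsto_arctan_primitive]
      simp

theorem stmt_12 :
    ∫ x in Set.Ioi (0:ℝ), (1 - x ^ 2 * Real.sin (1 / x) ^ 2) ^ 2 = Real.pi / 5 := by
  rw [← integral_comp_rpow_Ioi _ (neg_ne_zero.2 (one_ne_zero (α := ℝ)))]
  have : ∫ u in Ioi (0 : ℝ), (u ^ 2 - sin u ^ 2) ^ 2 / u ^ 6 = π / 5 := by
    rw [integral_eq_lintegral_of_nonneg_ae (.of_forall fun u => by
        simp only [Pi.zero_apply]; positivity)
      (Measurable.aestronglyMeasurable (by fun_prop)), lintegral_sq_sub_sin_sq_sq_div, ENNReal.toReal_ofReal (by positivity)]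
  rw [← this]
  refine setIntegral_congr_fun measurableSet_Ioi fun u hu => ?_
  have hu' : 0 < u := hu
  have h2 : u ^ (-1 - 1 : ℝ) = (u ^ 2)⁻¹ := by
    rw [show (-1 - 1 : ℝ) = -(2 : ℕ) by norm_num, rpow_neg hu'.le, rpow_natCast]
  simp only [h2, rpow_neg_one, one_div, inv_inv, abs_neg, abs_one, smul_eq_mul]
  field_simp
end

section
/- Let f : [−1,1] → ℝ be twice continuously differentiable with f(0) = 0. Then ( ∫_{−1}^{1} f(x) dx )² ≤ (1/10) · ∫_{−1}^{1} ( f″(x) )² dx. -/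
/-- Integrating by parts twice against the kernel `(x - c) ^ 2 / 2`. -/
lemma integral_kernel_mul_second_deriv {f f' f'' : ℝ → ℝ} {a b : ℝ} (c : ℝ) (hab : a ≤ b)
    (hf' : ∀ x ∈ Set.Icc a b, HasDerivWithinAt f (f' x) (Set.Icc a b) x)
    (hf'' : ∀ x ∈ Set.Icc a b, HasDerivWithinAt f' (f'' x) (Set.Icc a b) x)
    (hcont : ContinuousOn f'' (Set.Icc a b)) :
    ∫ x in a..b, (x - c) ^ 2 / 2 * f'' x = (∫ x in a..b, f x) +
      (((b - c) ^ 2 / 2 * f' b - (b - c) * f b) - ((a - c) ^ 2 / 2 * f' a - (a - c) * f a)) := by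
  have hfc : ContinuousOn f (Set.Icc a b) := fun x hx => (hf' x hx).continuousWithinAt
  have hfc' : ContinuousOn f' (Set.Icc a b) := fun x hx => (hf'' x hx).continuousWithinAt
  have hk : IntervalIntegrable (fun x => (x - c) ^ 2 / 2 * f'' x) MeasureTheory.volume a b :=
    ContinuousOn.intervalIntegrable_of_Icc hab (by fun_prop)
  have hi : IntervalIntegrable f MeasureTheory.volume a b :=
    hfc.intervalIntegrable_of_Icc hab
  have hFTC := intervalIntegral.integral_eq_sub_of_hasDerivAt_of_le hab
    (f := fun x => (x - c) ^ 2 / 2 * f' x - (x - c) * f x)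
    (f' := fun x => (x - c) ^ 2 / 2 * f'' x - f x) (by fun_prop)
    (fun x hx => by
      have hn := Icc_mem_nhds hx.1 hx.2
      have hd := (hf' x (Set.Ioo_subset_Icc_self hx)).hasDerivAt hn
      have hd' := (hf'' x (Set.Ioo_subset_Icc_self hx)).hasDerivAt hn
      have hl : HasDerivAt (fun y : ℝ => y - c) 1 x := (hasDerivAt_id x).sub_const c
      have hq : HasDerivAt (fun y : ℝ => (y - c) ^ 2 / 2) (x - c) x :=
        ((hl.pow 2).div_const 2).congr_deriv (by norm_num)
      exact ((hq.mul hd').sub (hl.mul hd)).congr_deriv (by ring)) (hk.sub hi)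
  rw [intervalIntegral.integral_sub hk hi] at hFTC
  linarith

/-- Expanding the nonnegative integral of `(g - t * (x - c) ^ 2 / 2) ^ 2`. -/
lemma kernel_quadratic_nonneg {g : ℝ → ℝ} {a b : ℝ} (c t : ℝ) (hab : a ≤ b)
    (hcont : ContinuousOn g (Set.Icc a b)) :
    0 ≤ (∫ x in a..b, g x ^ 2) - 2 * t * (∫ x in a..b, (x - c) ^ 2 / 2 * g x) +
      t ^ 2 * (((b - c) ^ 5 - (a - c) ^ 5) / 20) := by
  have hg : IntervalIntegrable (fun x => g x ^ 2) MeasureTheory.volume a b :=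
    ContinuousOn.intervalIntegrable_of_Icc hab (by fun_prop)
  have hk : IntervalIntegrable (fun x => 2 * t * ((x - c) ^ 2 / 2 * g x))
      MeasureTheory.volume a b :=
    ContinuousOn.intervalIntegrable_of_Icc hab (by fun_prop)
  have hp : IntervalIntegrable (fun x => t ^ 2 / 4 * (x - c) ^ 4) MeasureTheory.volume a b :=
    Continuous.intervalIntegrable (by fun_prop) a b
  have hpow : ∫ x in a..b, (x - c) ^ 4 = ((b - c) ^ 5 - (a - c) ^ 5) / 5 := by
    rw [intervalIntegral.integral_comp_sub_right (fun x => x ^ 4), integral_pow]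
    norm_num
  have hnn : 0 ≤ ∫ x in a..b, (g x - t * ((x - c) ^ 2 / 2)) ^ 2 :=
    intervalIntegral.integral_nonneg hab fun x _ => sq_nonneg _
  have hexp : ∀ x, (g x - t * ((x - c) ^ 2 / 2)) ^ 2 =
      g x ^ 2 - 2 * t * ((x - c) ^ 2 / 2 * g x) + t ^ 2 / 4 * (x - c) ^ 4 := fun x => by ring
  simp_rw [hexp] at hnn
  rw [intervalIntegral.integral_add (hg.sub hk) hp, intervalIntegral.integral_sub hg hk,
    intervalIntegral.integral_const_mul, intervalIntegral.integral_const_mul, hpow] at hnn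
  linarith

theorem stmt_13 (f f' f'' : ℝ → ℝ)
    (hf' : ∀ x ∈ Set.Icc (-1:ℝ) 1, HasDerivWithinAt f (f' x) (Set.Icc (-1) 1) x)
    (hf'' : ∀ x ∈ Set.Icc (-1:ℝ) 1, HasDerivWithinAt f' (f'' x) (Set.Icc (-1) 1) x)
    (hcont : ContinuousOn f'' (Set.Icc (-1) 1))
    (h0 : f 0 = 0) :
    (∫ x in (-1:ℝ)..1, f x) ^ 2 ≤ (1 / 10) * ∫ x in (-1:ℝ)..1, f'' x ^ 2 := by
  have hfc : ContinuousOn f (Set.Icc (-1) 1) := fun x hx => (hf' x hx).continuousWithinAt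
  have hsq : ContinuousOn (fun x => f'' x ^ 2) (Set.Icc (-1) 1) := by fun_prop
  have hl : Set.Icc (-1:ℝ) 0 ⊆ Set.Icc (-1) 1 := Set.Icc_subset_Icc_right zero_le_one
  have hr : Set.Icc (0:ℝ) 1 ⊆ Set.Icc (-1) 1 := Set.Icc_subset_Icc_left (by norm_num)
  have hneg : (-1:ℝ) ≤ 0 := by norm_num
  have hf_add := intervalIntegral.integral_add_adjacent_intervals
    ((hfc.mono hl).intervalIntegrable_of_Icc (μ := MeasureTheory.volume) hneg)
    ((hfc.mono hr).intervalIntegrable_of_Icc zero_le_one)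
  have hsq_add := intervalIntegral.integral_add_adjacent_intervals
    ((hsq.mono hl).intervalIntegrable_of_Icc (μ := MeasureTheory.volume) hneg)
    ((hsq.mono hr).intervalIntegrable_of_Icc zero_le_one)
  have hparts_l := integral_kernel_mul_second_deriv (-1) hneg
    (fun x hx => (hf' x (hl hx)).mono hl) (fun x hx => (hf'' x (hl hx)).mono hl) (hcont.mono hl)
  have hparts_r := integral_kernel_mul_second_deriv 1 zero_le_one
    (fun x hx => (hf' x (hr hx)).mono hr) (fun x hx => (hf'' x (hr hx)).mono hr) (hcont.mono hr)
  set t := 10 * ∫ x in (-1:ℝ)..1, f x with ht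
  have hquad_l := kernel_quadratic_nonneg (-1) t hneg (hcont.mono hl)
  have hquad_r := kernel_quadratic_nonneg 1 t zero_le_one (hcont.mono hr)
  rw [hparts_l, h0] at hquad_l
  rw [hparts_r, h0] at hquad_r
  norm_num at hquad_l hquad_r
  rw [← hsq_add]
  have hI : (∫ x in (-1:ℝ)..0, f x) = t / 10 - ∫ x in (0:ℝ)..1, f x := by linarith
  have hI' : (∫ x in (-1:ℝ)..1, f x) = t / 10 := by linarith
  rw [hI] at hquad_l
  rw [hI']
  linarith
end

section
/- Let f : [0,∞) → ℝ be monotonically increasing and suppose that f(x² + y + 1) = x·f(x) + f(y) + 1 for all x, y ≥ 0. Then f(x) = x for every x ≥ 0. -/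
/-- A monotone function on the nonnegative reals that fixes every natural number stays within
distance `1` of the identity. -/
theorem abs_sub_self_le_one {f : ℝ → ℝ} (hmono : MonotoneOn f (Set.Ici 0))
    (hnat : ∀ n : ℕ, f n = n) {x : ℝ} (hx : 0 ≤ x) : |f x - x| ≤ 1 := by
  have hle := Nat.floor_le hx
  have hlt := (Nat.lt_floor_add_one x).le
  have hlower := hmono (Set.mem_Ici.2 (Nat.cast_nonneg ⌊x⌋₊)) hx hle
  have hupper := hmono hx (Set.mem_Ici.2 (Nat.cast_nonneg (⌊x⌋₊ + 1))) (by push_cast; exact hlt)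
  rw [hnat] at hlower hupper
  push_cast at hupper
  rw [abs_le]
  constructor <;> linarith

theorem stmt_16 (f : ℝ → ℝ) (hmono : MonotoneOn f (Set.Ici 0))
    (hfe : ∀ x ≥ (0:ℝ), ∀ y ≥ (0:ℝ), f (x ^ 2 + y + 1) = x * f x + f y + 1) :
    ∀ x ≥ (0:ℝ), f x = x := by
  have hsucc : ∀ y ≥ (0:ℝ), f (y + 1) = f y + 1 := fun y hy => by
    simpa using hfe 0 le_rfl y hy
  have hsq : ∀ x ≥ (0:ℝ), f (x ^ 2) = x * f x + f 0 := fun x hx => by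
    have h := hfe x hx 0 le_rfl
    rw [add_zero, hsucc _ (sq_nonneg x)] at h
    linarith
  have hzero : f 0 = 0 := by simpa using hsq 1 zero_le_one
  have hadd : ∀ x ≥ (0:ℝ), ∀ n : ℕ, f (x + n) = f x + n := fun x hx n => by
    induction n with
    | zero => simp
    | succ n ih =>
      push_cast
      rw [← add_assoc, hsucc _ (by positivity), ih, add_assoc]
  have hnat : ∀ n : ℕ, f n = n := fun n => by simpa [hzero] using hadd 0 le_rfl n
  intro x hx
  by_contra hne
  have hpos : 0 < |f x - x| := abs_pos.2 (sub_ne_zero.2 hne)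
  obtain ⟨n, hn⟩ := exists_nat_gt (1 / |f x - x|)
  rw [div_lt_iff₀ hpos] at hn
  have hxn : 0 ≤ x + n := by positivity
  have hbound := abs_sub_self_le_one hmono hnat (sq_nonneg (x + n))
  have hfactor : f ((x + n) ^ 2) - (x + n) ^ 2 = (x + n) * (f x - x) := by
    rw [hsq _ hxn, hadd x hx, hzero]
    ring
  rw [hfactor, abs_mul, abs_of_nonneg hxn] at hbound
  nlinarith [mul_nonneg hx hpos.le]
end
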